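/- Let β be a quadratic Pisot unit with Galois conjugate β′, and let 𝒜 ∋ 0 be a finite set of consecutive integers with #𝒜 > β. Suppose that for an integer l ≥ 0 and j ∈ {1,…,⌊β⌋} one has β^{l−1}(β−1)·max{β−j, 1} < #𝒜 − 1 ≤ β^{l−1}(β−1)(β−j+1). Let α = β with 𝒜 = {0,1,…,m} and m > β − 1, or α as in the modified setting (α = −β, or α = β with {−1,0,1} ⊆ 𝒜). Then, up to finitely many exceptions, the distances between consecutive points of X^𝒜(α) take the three values β^{−l}, β^{−l}(j − β′), and β^{−l}(j + 1 − β′); moreover, enumerating X^𝒜(α) ∩ [0,∞) increasingly as y₀ < y₁ < y₂ < ⋯, the frequencies of these three gap values, i.e. the limits lim_{n→∞} (1/n)·#{ 0 ≤ k < n : y_{k+1} − y_k = Δ } for Δ equal to each of the three values, exist and equal 1 − β^{l−1}(β−1)/(#𝒜−1), 1 − β^{l−1}(β−j)(β−1)/(#𝒜−1), and −1 + β^{l−1}(β−j+1)(β−1)/(#𝒜−1), respectively. -/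

import Mathlib

/-- The spectrum `X^𝒜(α)` with digit alphabet `𝒜 = {a, a+1, …, A} ⊂ ℤ`. -/
def XspecZ (α : ℝ) (a A : ℤ) : Set ℝ :=
  {x | ∃ (n : ℕ) (c : ℕ → ℤ), (∀ j ≤ n, a ≤ c j ∧ c j ≤ A) ∧
    x = ∑ j ∈ Finset.range (n + 1), (c j : ℝ) * α ^ j}

/-- The sum of the ceilings of the first `V` terms of the progression `t, t + γ, t + 2γ, …`. -/
noncomputable def ceilSum (γ t : ℝ) (V : ℕ) : ℤ := ∑ v ∈ Finset.range V, ⌈t + v * γ⌉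

lemma ceilSum_add_int (γ t : ℝ) (b : ℤ) (V : ℕ) :
    ceilSum γ (t + b) V = ceilSum γ t V + V * b := by
  unfold ceilSum
  have h : ∀ v : ℕ, ⌈t + b + v * γ⌉ = ⌈t + v * γ⌉ + b := fun v => by
    rw [← Int.ceil_add_intCast]; congr 1; ring
  simp [h, Finset.sum_add_distrib]

lemma ceilSum_mono (γ : ℝ) (V : ℕ) : Monotone fun t => ceilSum γ t V := fun s t h =>
  Finset.sum_le_sum fun v _ => Int.ceil_mono (by linarith)

lemma ceilSum_add_slope (γ t : ℝ) (V : ℕ) :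
    ceilSum γ (t + γ) V = ceilSum γ t V + ⌈t + V * γ⌉ - ⌈t⌉ := by
  have h1 := Finset.sum_range_succ (fun v : ℕ => ⌈t + v * γ⌉) V
  have h2 := Finset.sum_range_succ' (fun v : ℕ => ⌈t + v * γ⌉) V
  have h3 : ∀ v : ℕ, ⌈t + ((v + 1 : ℕ) : ℝ) * γ⌉ = ⌈t + γ + v * γ⌉ := fun v => by
    congr 1; push_cast; ring
  simp only [h3, Nat.cast_zero, zero_mul, add_zero] at h2
  unfold ceilSum
  linarith

lemma abs_ceilSum_add_slope_sub (γ t : ℝ) (V : ℕ) :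
    |(ceilSum γ (t + γ) V : ℝ) - ceilSum γ t V - V * γ| ≤ 2 + 2 * |t| := by
  rw [ceilSum_add_slope]
  push_cast
  have h1 := Int.le_ceil (t + V * γ)
  have h2 := Int.ceil_lt_add_one (t + V * γ)
  have h3 := Int.le_ceil t
  have h4 := Int.ceil_lt_add_one t
  have h5 := neg_abs_le t
  have h6 := le_abs_self t
  rw [abs_le]
  constructor <;> linarith

lemma exists_abs_ceilSum_add_int_mul_slope_sub_le (γ : ℝ) (b : ℤ) :
    ∀ t : ℝ, ∃ C, ∀ V : ℕ, |(ceilSum γ (t + b * γ) V : ℝ) - ceilSum γ t V - V * (b * γ)| ≤ C := by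
  induction b using Int.induction_on with
  | zero => exact fun t => ⟨0, fun V => by simp⟩
  | succ i ih =>
    intro t
    obtain ⟨C, hC⟩ := ih t
    refine ⟨C + (2 + 2 * |t + i * γ|), fun V => ?_⟩
    have h1 := hC V
    have h2 := abs_ceilSum_add_slope_sub γ (t + i * γ) V
    have h3 : t + ((i + 1 : ℤ) : ℝ) * γ = t + i * γ + γ := by push_cast; ring
    rw [h3]
    push_cast at h1 ⊢
    rw [abs_le] at *
    constructor <;> linarith
  | pred i ih =>
    intro t
    obtain ⟨C, hC⟩ := ih t
    refine ⟨C + (2 + 2 * |t + ((-i - 1 : ℤ) : ℝ) * γ|), fun V => ?_⟩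
    have h1 := hC V
    have h2 := abs_ceilSum_add_slope_sub γ (t + ((-i - 1 : ℤ) : ℝ) * γ) V
    have h3 : t + ((-i - 1 : ℤ) : ℝ) * γ + γ = t + ((-i : ℤ) : ℝ) * γ := by push_cast; ring
    rw [h3] at h2
    push_cast at h1 h2 ⊢
    rw [abs_le] at *
    constructor <;> linarith

lemma exists_int_combination_between {γ : ℝ} (hγ : Irrational γ) {s t : ℝ} (h : s < t) :
    ∃ a b : ℤ, s < a + b * γ ∧ a + b * γ < t := by
  have hd : Dense (AddSubgroup.closure {γ, 1} : Set ℝ) :=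
    dense_addSubgroupClosure_pair_iff.2 (by simpa using hγ)
  obtain ⟨z, hz, hs, ht⟩ := hd.exists_between h
  obtain ⟨b, a, rfl⟩ := AddSubgroup.mem_closure_pair.1 hz
  exact ⟨a, b, by simpa [add_comm] using hs, by simpa [add_comm] using ht⟩

lemma exists_ceilSum_sub_le {γ : ℝ} (hγ : Irrational γ) (s t : ℝ) {ε : ℝ} (hε : 0 < ε) :
    ∃ C, ∀ V : ℕ, (ceilSum γ t V : ℝ) - ceilSum γ s V ≤ V * (t - s + ε) + C := by
  obtain ⟨a, b, h1, h2⟩ := exists_int_combination_between hγ (s := t - s) (t := t - s + ε)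
    (by linarith)
  obtain ⟨C, hC⟩ := exists_abs_ceilSum_add_int_mul_slope_sub_le γ b (s + a)
  refine ⟨C, fun V => ?_⟩
  have h3 : ceilSum γ t V ≤ ceilSum γ (s + a + b * γ) V := ceilSum_mono γ V (by linarith)
  have h4 := (abs_le.1 (hC V)).2
  have h5 : (V : ℝ) * (a + b * γ) ≤ V * (t - s + ε) :=
    mul_le_mul_of_nonneg_left h2.le (Nat.cast_nonneg V)
  have h6 : (ceilSum γ t V : ℝ) ≤ ceilSum γ (s + a + b * γ) V := by exact_mod_cast h3
  have h7 := ceilSum_add_int γ s a V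
  have h8 : (ceilSum γ (s + a) V : ℝ) = ceilSum γ s V + V * a := by exact_mod_cast h7
  linarith

/-- The integer points `(v, u)` with `0 ≤ v < V` and `s ≤ u - v * γ < t`. -/
noncomputable def stripPoints (γ s t : ℝ) (V : ℕ) : Finset (Σ _ : ℕ, ℤ) :=
  (Finset.range V).sigma fun v => Finset.Ico ⌈s + v * γ⌉ ⌈t + v * γ⌉

lemma mem_stripPoints {γ s t : ℝ} {V : ℕ} {q : Σ _ : ℕ, ℤ} :
    q ∈ stripPoints γ s t V ↔ q.1 < V ∧ s ≤ q.2 - q.1 * γ ∧ q.2 - q.1 * γ < t := by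
  simp only [stripPoints, Finset.mem_sigma, Finset.mem_range, Finset.mem_Ico, Int.ceil_le,
    Int.lt_ceil, le_sub_iff_add_le, sub_lt_iff_lt_add]

lemma card_stripPoints {γ s t : ℝ} (h : s ≤ t) (V : ℕ) :
    ((stripPoints γ s t V).card : ℝ) = ceilSum γ t V - ceilSum γ s V := by
  rw [stripPoints, Finset.card_sigma]
  have h1 : ∀ v : ℕ, (((Finset.Ico ⌈s + v * γ⌉ ⌈t + v * γ⌉).card : ℕ) : ℤ)
      = ⌈t + v * γ⌉ - ⌈s + v * γ⌉ := fun v => by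
    rw [Int.card_Ico, Int.toNat_of_nonneg]
    exact sub_nonneg.2 (Int.ceil_mono (by linarith))
  have h2 : ((∑ v ∈ Finset.range V, (Finset.Ico ⌈s + v * γ⌉ ⌈t + v * γ⌉).card : ℕ) : ℤ)
      = ceilSum γ t V - ceilSum γ s V := by
    push_cast [h1]
    simp [ceilSum, Finset.sum_sub_distrib]
  exact_mod_cast h2

lemma exists_card_stripPoints_le {γ : ℝ} (hγ : Irrational γ) {s t : ℝ} (h : s ≤ t) {ε : ℝ}
    (hε : 0 < ε) : ∃ C, ∀ V : ℕ, ((stripPoints γ s t V).card : ℝ) ≤ V * (t - s + ε) + C := by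
  simp_rw [card_stripPoints h]
  exact exists_ceilSum_sub_le hγ s t hε

lemma exists_le_card_stripPoints {γ : ℝ} (hγ : Irrational γ) {s t : ℝ} (h : s ≤ t) {ε : ℝ}
    (hε : 0 < ε) : ∃ C, ∀ V : ℕ, (V : ℝ) * (t - s - ε) - C ≤ (stripPoints γ s t V).card := by
  simp_rw [card_stripPoints h]
  obtain ⟨C, hC⟩ := exists_ceilSum_sub_le hγ t s hε
  refine ⟨C, fun V => ?_⟩
  linarith [hC V]

/-- A set of reals which, up to points near the boundary of the window and up to a part bounded
above, is the cut-and-project set of the points `u * g₁ + v * g₂` with `u - v * γ ∈ [c, c + L]`. -/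
structure IsStripSet (g₁ g₂ γ c L : ℝ) (X : Set ℝ) : Prop where
  subset : ∀ x ∈ X, ∃ u v : ℤ, x = u * g₁ + v * g₂ ∧ c ≤ u - v * γ ∧ u - v * γ ≤ c + L
  mem : ∀ ε > 0, ∃ R : ℝ, ∀ u v : ℤ, R ≤ u * g₁ + v * g₂ → c + ε ≤ u - v * γ →
    u - v * γ ≤ c + L - ε → u * g₁ + v * g₂ ∈ X

lemma int_pair_eq_of_irrational {γ : ℝ} (hγ : Irrational γ) {u v u' v' : ℤ}
    (h : (u : ℝ) + v * γ = u' + v' * γ) : u = u' ∧ v = v' := by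
  have hv : v = v' := by
    by_contra hne
    have hne' : ((v - v' : ℤ) : ℝ) ≠ 0 := by exact_mod_cast sub_ne_zero.2 hne
    refine hγ ⟨((u' - u : ℤ) : ℚ) / ((v - v' : ℤ) : ℚ), ?_⟩
    push_cast at hne' ⊢
    rw [div_eq_iff hne']
    linarith
  subst hv
  exact ⟨by exact_mod_cast add_right_cancel h, rfl⟩

lemma int_pair_eq_of_irrational_div {g₁ g₂ : ℝ} (h₁ : 0 < g₁) (hg : Irrational (g₂ / g₁))
    {u v u' v' : ℤ} (h : u * g₁ + v * g₂ = u' * g₁ + v' * g₂) : u = u' ∧ v = v' := by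
  refine int_pair_eq_of_irrational hg ?_
  field_simp
  linarith

lemma exists_lt_of_sub_mul_eq {γ : ℝ} (hγ : Irrational γ) (g₁ g₂ t : ℝ) :
    ∃ R : ℝ, ∀ u v : ℤ, u - v * γ = t → u * g₁ + v * g₂ < R := by
  by_cases h : ∃ u v : ℤ, u - v * γ = t
  · obtain ⟨u, v, h⟩ := h
    refine ⟨u * g₁ + v * g₂ + 1, fun u' v' h' => ?_⟩
    obtain ⟨rfl, h2⟩ := int_pair_eq_of_irrational hγ (u := u) (v := -v) (u' := u') (v' := -v')
      (by push_cast; linarith)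
    obtain rfl : v = v' := by omega
    linarith
  · push Not at h
    exact ⟨0, fun u v h' => absurd h' (h u v)⟩

theorem IsStripSet.exists_gap_mem {g₁ g₂ γ c L : ℝ} {X : Set ℝ} (hX : IsStripSet g₁ g₂ γ c L X)
    (h₁ : 0 < g₁) (h₂ : 0 < g₂) (hγ : Irrational γ) (hγ0 : 0 < γ) (hL1 : 1 < L) (hLγ : γ < L)
    (hL : L ≤ 1 + γ) :
    ∃ R : ℝ, ∀ x ∈ X, ∀ z ∈ X, R ≤ x → x < z → (∀ w ∈ X, w ≤ x ∨ z ≤ w) →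
      z - x = g₁ ∨ z - x = g₂ ∨ z - x = g₁ + g₂ := by
  obtain ⟨R₁, hR₁⟩ := exists_lt_of_sub_mul_eq hγ g₁ g₂ c
  obtain ⟨R₂, hR₂⟩ := exists_lt_of_sub_mul_eq hγ g₁ g₂ (c + L)
  obtain ⟨ε, hε, hε1, hεγ, hεL, hεLγ⟩ : ∃ ε > 0, ε ≤ 1 ∧ ε ≤ γ ∧ 2 * ε ≤ L - 1 ∧ 2 * ε ≤ L - γ := by
    refine ⟨min (min 1 γ) (min ((L - 1) / 2) ((L - γ) / 2)), ?_, ?_, ?_, ?_, ?_⟩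
    · have : 0 < (L - 1) / 2 := by linarith
      have : 0 < (L - γ) / 2 := by linarith
      positivity
    · exact (min_le_left _ _).trans (min_le_left _ _)
    · exact (min_le_left _ _).trans (min_le_right _ _)
    · have := (min_le_right (min 1 γ) (min ((L - 1) / 2) ((L - γ) / 2))).trans (min_le_left _ _)
      linarith
    · have := (min_le_right (min 1 γ) (min ((L - 1) / 2) ((L - γ) / 2))).trans (min_le_right _ _)
      linarith
  obtain ⟨R₃, hR₃⟩ := hX.mem ε hε
  refine ⟨max R₁ (max R₂ R₃), fun x hx z hz hRx hxz hgap => ?_⟩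
  obtain ⟨hx1, hx2, hx3⟩ : R₁ ≤ x ∧ R₂ ≤ x ∧ R₃ ≤ x := by simpa using hRx
  obtain ⟨u, v, rfl, hφ1, hφ2⟩ := hX.subset x hx
  obtain ⟨u', v', rfl, hψ1, hψ2⟩ := hX.subset z hz
  obtain ⟨m, rfl⟩ : ∃ m, u' = u + m := ⟨u' - u, by ring⟩
  obtain ⟨n, rfl⟩ : ∃ n, v' = v + n := ⟨v' - v, by ring⟩
  push_cast at hxz hψ1 hψ2 hgap ⊢
  have hne1 : (u : ℝ) - v * γ ≠ c := fun h => absurd (hR₁ u v h) (not_lt.2 hx1)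
  have hne2 : (u : ℝ) - v * γ ≠ c + L := fun h => absurd (hR₂ u v h) (not_lt.2 hx2)
  have hφ1' := lt_of_le_of_ne hφ1 hne1.symm
  have hφ2' := lt_of_le_of_ne hφ2 hne2
  have hmn : 0 ≤ m ∧ 0 ≤ n := by
    by_contra hcon
    rcases lt_or_ge 0 m with hm | hm
    · have hn : n ≤ -1 := by by_contra h; exact hcon ⟨hm.le, by omega⟩
      have hm' : (1 : ℝ) ≤ m := by exact_mod_cast hm
      have hn' : (n : ℝ) ≤ -1 := by exact_mod_cast hn
      nlinarith
    · rcases lt_or_ge 0 n with hn | hn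
      · have hm : m ≤ -1 := by by_contra h; exact hcon ⟨by omega, hn.le⟩
        have hn' : (1 : ℝ) ≤ n := by exact_mod_cast hn
        have hm' : (m : ℝ) ≤ -1 := by exact_mod_cast hm
        nlinarith
      · have hn' : (n : ℝ) ≤ 0 := by exact_mod_cast hn
        have hm' : (m : ℝ) ≤ 0 := by exact_mod_cast hm
        nlinarith
  obtain ⟨hm, hn⟩ := hmn
  have key : ∀ i k : ℤ, 0 ≤ i → 0 ≤ k → 0 < i + k →
      (i : ℝ) * g₁ + k * g₂ < m * g₁ + n * g₂ →
      (u : ℝ) + i - (v + k) * γ < c + ε ∨ c + L - ε < (u : ℝ) + i - (v + k) * γ := by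
    intro i k hi hk hik hlt
    by_contra hcon
    push Not at hcon
    have hi' : (0 : ℝ) ≤ i := by exact_mod_cast hi
    have hk' : (0 : ℝ) ≤ k := by exact_mod_cast hk
    have hpos : 0 < (i : ℝ) * g₁ + k * g₂ := by
      rcases hi.lt_or_eq with h | h
      · have : (0 : ℝ) < i := by exact_mod_cast h
        positivity
      · have : (0 : ℝ) < k := by exact_mod_cast (by omega : 0 < k)
        positivity
    have hmem := hR₃ (u + i) (v + k) (by push_cast; nlinarith) (by push_cast; exact hcon.1)
      (by push_cast; exact hcon.2)
    have := hgap _ hmem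
    push_cast at this
    rcases this with h | h <;> nlinarith
  rcases hm.lt_or_eq with hm1 | rfl
  · have hm' : (1 : ℝ) ≤ m := by exact_mod_cast hm1
    rcases hn.lt_or_eq with hn1 | rfl
    · have hn' : (1 : ℝ) ≤ n := by exact_mod_cast hn1
      by_cases h11 : m = 1 ∧ n = 1
      · obtain ⟨rfl, rfl⟩ := h11
        right; right; push_cast; ring
      · exfalso
        have hbig : (3 : ℝ) ≤ m + n := by exact_mod_cast (by omega : 3 ≤ m + n)
        have h10 := key 1 0 (by norm_num) (by norm_num) (by norm_num) (by push_cast; nlinarith)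
        have h01 := key 0 1 (by norm_num) (by norm_num) (by norm_num) (by push_cast; nlinarith)
        have h11' := key 1 1 (by norm_num) (by norm_num) (by norm_num) (by
          push_cast
          rcases (show 2 ≤ m ∨ 2 ≤ n by omega) with h | h
          · have : (2 : ℝ) ≤ m := by exact_mod_cast h
            nlinarith
          · have : (2 : ℝ) ≤ n := by exact_mod_cast h
            nlinarith)
        push_cast at h10 h01 h11'
        rcases h10 with h | h <;> rcases h01 with h' | h' <;> rcases h11' with h'' | h'' <;> linarith
    · left
      have : m = 1 := by
        by_contra hne
        have h2 : (2 : ℝ) ≤ m := by exact_mod_cast (by omega : 2 ≤ m)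
        have h10 := key 1 0 (by norm_num) (by norm_num) (by norm_num) (by push_cast; nlinarith)
        push_cast at h10 hψ2
        rcases h10 with h | h <;> linarith
      subst this
      push_cast; ring
  · rcases hn.lt_or_eq with hn1 | rfl
    · right; left
      have : n = 1 := by
        by_contra hne
        have h2 : (2 : ℝ) ≤ n := by exact_mod_cast (by omega : 2 ≤ n)
        have h01 := key 0 1 (by norm_num) (by norm_num) (by norm_num) (by push_cast; nlinarith)
        push_cast at h01 hψ1
        rcases h01 with h | h <;> nlinarith
      subst this
      push_cast; ring
    · simp at hxz

open Filter Topology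

lemma tendsto_div_natCast_of_abs_sub_le {v : ℕ → ℝ} {L : ℝ} (hL : 0 < L)
    (hv : Tendsto v atTop atTop)
    (h : ∀ ε > 0, ∃ C, ∀ᶠ n : ℕ in atTop, |(n : ℝ) - L * v n| ≤ ε * v n + C) :
    Tendsto (fun n => v n / n) atTop (𝓝 (1 / L)) := by
  have h1 : Tendsto (fun n : ℕ => (n : ℝ) / v n) atTop (𝓝 L) := by
    rw [Metric.tendsto_atTop']
    intro ε hε
    obtain ⟨C, hC⟩ := h (ε / 2) (by positivity)
    have h2 := hv.eventually_gt_atTop (max 0 (2 * C / ε))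
    obtain ⟨N, hN⟩ := (hC.and h2).exists_forall_of_atTop
    refine ⟨N, fun n hn => ?_⟩
    obtain ⟨h3, h4⟩ := hN n hn.le
    obtain ⟨h5, h6⟩ := max_lt_iff.1 h4
    rw [div_lt_iff₀ hε] at h6
    rw [Real.dist_eq, div_sub' h5.ne', abs_div, abs_of_pos h5, div_lt_iff₀ h5, mul_comm (v n) L]
    linarith
  have h3 := h1.inv₀ hL.ne'
  simpa [inv_div] using h3

lemma tendsto_atTop_of_strictMono_of_strip {g₁ g₂ γ c L : ℝ} {y : ℕ → ℝ} {u v : ℕ → ℤ}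
    (h₁ : 0 < g₁) (h₂ : 0 < g₂) (hγ0 : 0 < γ) (hy : StrictMono y)
    (hyuv : ∀ k, y k = u k * g₁ + v k * g₂) (hc : ∀ k, c ≤ u k - v k * γ)
    (hcL : ∀ k, u k - v k * γ ≤ c + L) (hy0 : ∀ k, 0 ≤ y k) :
    Tendsto y atTop atTop := by
  refine tendsto_atTop_atTop_of_monotone hy.monotone fun T => ?_
  by_contra hcon
  push Not at hcon
  have hG : 0 < γ * g₁ + g₂ := by positivity
  have hv : ∀ k, y k = (u k - v k * γ) * g₁ + v k * (γ * g₁ + g₂) := fun k => by rw [hyuv]; ring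
  have hlow : ∀ k, -((c + L) * g₁ / (γ * g₁ + g₂)) ≤ v k := fun k => by
    rw [neg_le_iff_add_nonneg', div_add' _ _ _ hG.ne']
    refine div_nonneg ?_ hG.le
    nlinarith [hv k, hy0 k, hcL k]
  have hup : ∀ k, (v k : ℝ) ≤ (T - c * g₁) / (γ * g₁ + g₂) := fun k => by
    rw [le_div_iff₀ hG]
    nlinarith [hv k, hcon k, hc k]
  obtain ⟨N, hN⟩ := exists_nat_ge (max ((c + L) * g₁ / (γ * g₁ + g₂)) ((T - c * g₁) / (γ * g₁ + g₂)))
  have hN1 := (le_max_left _ _).trans hN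
  have hN2 := (le_max_right _ _).trans hN
  have hvN : ∀ k, -(N : ℝ) ≤ v k ∧ (v k : ℝ) ≤ N := fun k =>
    ⟨by linarith [hlow k], by linarith [hup k]⟩
  obtain ⟨M, hM⟩ := exists_nat_ge (max (|c| + N * γ) (|c + L| + N * γ))
  have hM1 := (le_max_left _ _).trans hM
  have hM2 := (le_max_right _ _).trans hM
  have huM : ∀ k, -(M : ℝ) ≤ u k ∧ (u k : ℝ) ≤ M := fun k => by
    constructor
    · nlinarith [hc k, neg_abs_le c, (hvN k).1]
    · nlinarith [hcL k, le_abs_self (c + L), (hvN k).2]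
  refine Set.infinite_of_injective_forall_mem (f := fun k => (u k, v k))
    (s := Set.Icc (-M : ℤ) M ×ˢ Set.Icc (-N : ℤ) N) ?_ ?_
    ((Set.finite_Icc _ _).prod (Set.finite_Icc _ _))
  · intro k k' h
    simp only [Prod.mk.injEq] at h
    exact hy.injective (by rw [hyuv, hyuv, h.1, h.2])
  · intro k
    have h1 := hvN k
    have h2 := huM k
    simp only [Set.mem_prod, Set.mem_Icc]
    exact ⟨⟨by exact_mod_cast h2.1, by exact_mod_cast h2.2⟩,
      ⟨by exact_mod_cast h1.1, by exact_mod_cast h1.2⟩⟩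

lemma IsStripSet.tendsto_snd_div {g₁ g₂ γ c L : ℝ} {X : Set ℝ} (hX : IsStripSet g₁ g₂ γ c L X)
    (h₁ : 0 < g₁) (h₂ : 0 < g₂) (hg : Irrational (g₂ / g₁)) (hγ : Irrational γ) (hγ0 : 0 < γ)
    (hL0 : 0 < L) {y : ℕ → ℝ} (hy : StrictMono y) (hr : Set.range y = X ∩ Set.Ici 0)
    {u v : ℕ → ℤ} (hyuv : ∀ k, y k = u k * g₁ + v k * g₂) (hc : ∀ k, c ≤ u k - v k * γ)
    (hcL : ∀ k, u k - v k * γ ≤ c + L) (hv : Tendsto v atTop atTop) :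
    Tendsto (fun n => (v n : ℝ) / n) atTop (𝓝 (1 / L)) := by
  have hG : 0 < γ * g₁ + g₂ := by positivity
  have hvG : ∀ k, y k = (u k - v k * γ) * g₁ + v k * (γ * g₁ + g₂) := fun k => by rw [hyuv]; ring
  obtain ⟨b, hb⟩ := exists_nat_gt (L * g₁ / (γ * g₁ + g₂))
  rw [div_lt_iff₀ hG] at hb
  have hcmp : ∀ k n, y k ≤ y n → v k < v n + b := fun k n hkn => by
    have : (v k : ℝ) * (γ * g₁ + g₂) < (v n + b) * (γ * g₁ + g₂) := by
      nlinarith [hvG k, hvG n, hc k, hcL n]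
    exact_mod_cast lt_of_mul_lt_mul_right this hG.le
  refine tendsto_div_natCast_of_abs_sub_le hL0 (tendsto_intCast_atTop_atTop.comp hv) fun ε' hε' => ?_
  obtain ⟨ε, hε, hεε', hεL⟩ : ∃ ε > 0, 3 * ε ≤ ε' ∧ 3 * ε ≤ L :=
    ⟨min (ε' / 3) (L / 3), by positivity, by linarith [min_le_left (ε' / 3) (L / 3)],
      by linarith [min_le_right (ε' / 3) (L / 3)]⟩
  obtain ⟨k₁, hk₁⟩ := (hv.eventually_ge_atTop 0).exists_forall_of_atTop
  obtain ⟨C₁, hC₁⟩ := exists_card_stripPoints_le hγ (s := c) (t := c + L + ε) (by linarith) hε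
  obtain ⟨C₂, hC₂⟩ := exists_le_card_stripPoints hγ (s := c + ε) (t := c + L - ε) (by linarith) hε
  obtain ⟨R, hR⟩ := hX.mem ε hε
  obtain ⟨V₀, hV₀⟩ := exists_nat_gt ((max R 0 - c * g₁) / (γ * g₁ + g₂))
  rw [div_lt_iff₀ hG] at hV₀
  have hupper : ∀ n, 0 ≤ v n → (n : ℝ) ≤ k₁ + ((v n + b) * (L + 2 * ε) + C₁) := by
    intro n hn
    have hcard : (Finset.range n \ Finset.range k₁).card
        ≤ (stripPoints γ c (c + L + ε) (v n + b).toNat).card := by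
      refine Finset.card_le_card_of_injOn (fun k => ⟨(v k).toNat, u k⟩) (fun k hk => ?_) ?_
      · simp only [Finset.coe_sdiff, Finset.coe_range, Set.mem_sdiff, Set.mem_Iio, not_lt] at hk
        have hvk := hk₁ k hk.2
        have hcast : (((v k).toNat : ℕ) : ℝ) = v k := by exact_mod_cast Int.toNat_of_nonneg hvk
        rw [Finset.mem_coe, mem_stripPoints]
        simp only [hcast]
        refine ⟨?_, hc k, by linarith [hcL k]⟩
        have := hcmp k n (hy.monotone hk.1.le)
        omega
      · intro k hk k' hk' h
        simp only [Finset.coe_sdiff, Finset.coe_range, Set.mem_sdiff, Set.mem_Iio, not_lt] at hk hk'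
        have hvk := hk₁ k hk.2
        have hvk' := hk₁ k' hk'.2
        simp only [Sigma.mk.injEq, heq_eq_eq] at h
        have hvv : v k = v k' := by omega
        exact hy.injective (by rw [hyuv, hyuv, h.2, hvv])
    have hn1 : n ≤ k₁ + (Finset.range n \ Finset.range k₁).card := by
      have := Finset.le_card_sdiff (Finset.range k₁) (Finset.range n)
      simp only [Finset.card_range] at this
      omega
    have hn2 : (n : ℝ) ≤ k₁ + (stripPoints γ c (c + L + ε) (v n + b).toNat).card := by
      exact_mod_cast hn1.trans (Nat.add_le_add_left hcard k₁)
    have hcast : (((v n + b).toNat : ℕ) : ℝ) = v n + b := by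
      exact_mod_cast Int.toNat_of_nonneg (by omega : 0 ≤ v n + b)
    have := hC₁ (v n + b).toNat
    rw [hcast] at this
    linarith
  have hlower : ∀ n, (b : ℤ) ≤ v n → (v n - b) * (L - 3 * ε) - C₂
      ≤ n + (stripPoints γ (c + ε) (c + L - ε) V₀).card := by
    intro n hn
    have hsub : stripPoints γ (c + ε) (c + L - ε) (v n - b).toNat ⊆
        (Finset.range n).image (fun k => (⟨(v k).toNat, u k⟩ : Σ _ : ℕ, ℤ)) ∪
          stripPoints γ (c + ε) (c + L - ε) V₀ := by
      rintro ⟨w, z⟩ hq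
      rw [mem_stripPoints] at hq
      obtain ⟨hq1, hq2, hq3⟩ := hq
      simp only at hq1 hq2 hq3
      rw [Finset.mem_union]
      by_cases hpos : max R 0 ≤ z * g₁ + w * g₂
      · left
        obtain ⟨hpR, hp0⟩ := max_le_iff.1 hpos
        have hmem := hR z w (by exact_mod_cast hpR) (by exact_mod_cast hq2)
          (by push_cast; exact hq3.le)
        have hmem' : (z : ℝ) * g₁ + ((w : ℤ) : ℝ) * g₂ ∈ Set.range y := by
          rw [hr]
          exact ⟨hmem, by exact_mod_cast hp0⟩
        obtain ⟨k, hk⟩ := hmem'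
        rw [hyuv] at hk
        obtain ⟨hzu, hwv⟩ := int_pair_eq_of_irrational_div h₁ hg hk
        rw [Finset.mem_image]
        refine ⟨k, ?_, by simp [hzu, hwv]⟩
        rw [Finset.mem_range]
        by_contra hkn
        have := hcmp n k (hy.monotone (not_lt.1 hkn))
        omega
      · right
        rw [mem_stripPoints]
        refine ⟨?_, hq2, hq3⟩
        have : (w : ℝ) * (γ * g₁ + g₂) < V₀ * (γ * g₁ + g₂) := by nlinarith
        exact_mod_cast lt_of_mul_lt_mul_right this hG.le
    have hcard := (Finset.card_le_card hsub).trans (Finset.card_union_le _ _)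
    have hcard' := hcard.trans (Nat.add_le_add_right Finset.card_image_le _)
    rw [Finset.card_range] at hcard'
    have hcast : (((v n - b).toNat : ℕ) : ℝ) = v n - b := by
      exact_mod_cast Int.toNat_of_nonneg (by omega : 0 ≤ v n - b)
    have h3 := hC₂ (v n - b).toNat
    rw [hcast] at h3
    have h4 : ((stripPoints γ (c + ε) (c + L - ε) (v n - b).toNat).card : ℝ)
      ≤ n + (stripPoints γ (c + ε) (c + L - ε) V₀).card := by exact_mod_cast hcard'
    linarith
  refine ⟨max (k₁ + (b * (L + 2 * ε) + C₁))
    ((stripPoints γ (c + ε) (c + L - ε) V₀).card + b * (L - 3 * ε) + C₂), ?_⟩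
  filter_upwards [hv.eventually_ge_atTop (b : ℤ)] with n hn
  have hn0 : 0 ≤ v n := by omega
  have h5 := hupper n hn0
  have h6 := hlower n hn
  have h7 : (0 : ℝ) ≤ v n := by exact_mod_cast hn0
  have h8 := mul_le_mul_of_nonneg_right hεε' h7
  have h9 := mul_nonneg hε.le h7
  rw [abs_le]
  constructor
  · have := le_max_right (k₁ + (b * (L + 2 * ε) + C₁))
      ((stripPoints γ (c + ε) (c + L - ε) V₀).card + b * (L - 3 * ε) + C₂)
    linarith
  · have := le_max_left (k₁ + (b * (L + 2 * ε) + C₁))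
      ((stripPoints γ (c + ε) (c + L - ε) V₀).card + b * (L - 3 * ε) + C₂)
    linarith

lemma tendsto_card_filter_div {P : ℕ → Prop} [DecidablePred P] {f : ℕ → ℝ} {θ : ℝ} {k₀ : ℕ}
    (hf : Tendsto (fun n => f n / n) atTop (𝓝 θ))
    (h : ∀ n ≥ k₀, f (n + 1) - f n = if P n then 1 else 0) :
    Tendsto (fun n => (((Finset.range n).filter P).card : ℝ) / n) atTop (𝓝 θ) := by
  have hconst : ∀ n ≥ k₀, (((Finset.range n).filter P).card : ℝ)
      = f n + ((((Finset.range k₀).filter P).card : ℝ) - f k₀) := by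
    intro n hn
    induction n, hn using Nat.le_induction with
    | base => ring
    | succ n hn ih =>
      have := h n hn
      rw [Finset.range_add_one, Finset.filter_insert]
      by_cases hP : P n
      · rw [if_pos hP] at this ⊢
        rw [Finset.card_insert_of_notMem (by simp)]
        push_cast
        linarith
      · rw [if_neg hP] at this ⊢
        linarith
  have h0 := hf.add (tendsto_const_div_atTop_nhds_zero_nat
    ((((Finset.range k₀).filter P).card : ℝ) - f k₀))
  rw [add_zero] at h0
  refine h0.congr' ?_
  filter_upwards [eventually_ge_atTop k₀] with n hn
  rw [hconst n hn, add_div]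

theorem IsStripSet.tendsto_gap_frequencies {g₁ g₂ γ c L : ℝ} {X : Set ℝ}
    (hX : IsStripSet g₁ g₂ γ c L X) (h₁ : 0 < g₁) (h₂ : 0 < g₂) (hg : Irrational (g₂ / g₁))
    (hγ : Irrational γ) (hγ0 : 0 < γ) (hL1 : 1 < L) (hLγ : γ < L) (hL : L ≤ 1 + γ)
    {y : ℕ → ℝ} (hy : StrictMono y) (hr : Set.range y = X ∩ Set.Ici 0) :
    Tendsto (fun n => (((Finset.range n).filter
        (fun k => y (k + 1) - y k = g₁)).card : ℝ) / (n : ℝ)) atTop (𝓝 (1 - 1 / L)) ∧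
    Tendsto (fun n => (((Finset.range n).filter
        (fun k => y (k + 1) - y k = g₂)).card : ℝ) / (n : ℝ)) atTop (𝓝 (1 - γ / L)) ∧
    Tendsto (fun n => (((Finset.range n).filter
        (fun k => y (k + 1) - y k = g₁ + g₂)).card : ℝ) / (n : ℝ)) atTop
      (𝓝 ((1 + γ) / L - 1)) := by
  have hmemX : ∀ k, y k ∈ X ∩ Set.Ici 0 := fun k => hr ▸ Set.mem_range_self k
  choose u v hyuv hc hcL using fun k => hX.subset (y k) (hmemX k).1
  have hyT := tendsto_atTop_of_strictMono_of_strip h₁ h₂ hγ0 hy hyuv hc hcL fun k => (hmemX k).2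
  have hG : 0 < γ * g₁ + g₂ := by positivity
  have hvT : Tendsto v atTop atTop := by
    rw [← tendsto_intCast_atTop_iff (R := ℝ)]
    refine tendsto_atTop_mono (fun k => ?_) ((tendsto_atTop_add_const_right _
      (-((c + L) * g₁)) hyT).atTop_div_const hG)
    rw [div_le_iff₀ hG]
    nlinarith [hyuv k, hcL k]
  have hvlim := hX.tendsto_snd_div h₁ h₂ hg hγ hγ0 (by linarith) hy hr hyuv hc hcL hvT
  have hφlim : Tendsto (fun n : ℕ => ((u n : ℝ) - v n * γ) / n) atTop (𝓝 0) := by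
    refine squeeze_zero_norm' (a := fun n : ℕ => (|c| + |c + L|) / n) ?_
      (tendsto_const_div_atTop_nhds_zero_nat _)
    filter_upwards with n
    rw [norm_div, Real.norm_eq_abs, RCLike.norm_natCast]
    refine div_le_div_of_nonneg_right (abs_le.2 ⟨?_, ?_⟩) (Nat.cast_nonneg n)
    · linarith [hc n, neg_abs_le c, abs_nonneg (c + L)]
    · linarith [hcL n, le_abs_self (c + L), abs_nonneg c]
  have hulim : Tendsto (fun n => (u n : ℝ) / n) atTop (𝓝 (γ / L)) := by
    have := hφlim.add (hvlim.mul_const γ)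
    rw [zero_add, one_div_mul_eq_div] at this
    refine this.congr fun n => ?_
    ring
  have hnlim : Tendsto (fun n : ℕ => (n : ℝ) / n) atTop (𝓝 1) := by
    refine tendsto_const_nhds.congr' ?_
    filter_upwards [eventually_gt_atTop 0] with n hn
    rw [div_self (by exact_mod_cast hn.ne')]
  obtain ⟨R, hR⟩ := hX.exists_gap_mem h₁ h₂ hγ hγ0 hL1 hLγ hL
  obtain ⟨k₀, hk₀⟩ := (hyT.eventually_ge_atTop R).exists_forall_of_atTop
  have hstep : ∀ k ≥ k₀,
      (u (k + 1) = u k + 1 ∧ v (k + 1) = v k ∧ y (k + 1) - y k = g₁) ∨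
      (u (k + 1) = u k ∧ v (k + 1) = v k + 1 ∧ y (k + 1) - y k = g₂) ∨
      (u (k + 1) = u k + 1 ∧ v (k + 1) = v k + 1 ∧ y (k + 1) - y k = g₁ + g₂) := by
    intro k hk
    have hgap : ∀ w ∈ X, w ≤ y k ∨ y (k + 1) ≤ w := by
      intro w hw
      rcases lt_or_ge w 0 with hw0 | hw0
      · exact Or.inl (hw0.le.trans (hmemX k).2)
      · obtain ⟨i, rfl⟩ : w ∈ Set.range y := by rw [hr]; exact ⟨hw, hw0⟩
        rcases le_or_gt i k with h | h
        · exact Or.inl (hy.monotone h)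
        · exact Or.inr (hy.monotone h)
    have hsucc := hyuv (k + 1)
    have hk' := hyuv k
    rcases hR _ (hmemX k).1 _ (hmemX (k + 1)).1 (hk₀ k hk) (hy (Nat.lt_succ_self k)) hgap with
      h | h | h
    · obtain ⟨e1, e2⟩ := int_pair_eq_of_irrational_div h₁ hg (u := u (k + 1)) (v := v (k + 1))
        (u' := u k + 1) (v' := v k) (by push_cast; linarith)
      exact Or.inl ⟨e1, e2, h⟩
    · obtain ⟨e1, e2⟩ := int_pair_eq_of_irrational_div h₁ hg (u := u (k + 1)) (v := v (k + 1))
        (u' := u k) (v' := v k + 1) (by push_cast; linarith)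
      exact Or.inr (Or.inl ⟨e1, e2, h⟩)
    · obtain ⟨e1, e2⟩ := int_pair_eq_of_irrational_div h₁ hg (u := u (k + 1)) (v := v (k + 1))
        (u' := u k + 1) (v' := v k + 1) (by push_cast; linarith)
      exact Or.inr (Or.inr ⟨e1, e2, h⟩)
  have hne : g₁ ≠ g₂ := fun h => by
    obtain ⟨h, -⟩ := int_pair_eq_of_irrational_div h₁ hg (u := 1) (v := 0) (u' := 0) (v' := 1)
      (by push_cast; linarith)
    exact absurd h (by norm_num)
  refine ⟨?_, ?_, ?_⟩
  · refine tendsto_card_filter_div (k₀ := k₀) (f := fun n => n - v n) ?_ fun n hn => ?_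
    · exact (hnlim.sub hvlim).congr fun n => by ring
    · rcases hstep n hn with ⟨-, e, h⟩ | ⟨-, e, h⟩ | ⟨-, e, h⟩ <;> simp only [h, e] <;> push_cast
      · ring
      · rw [if_neg hne.symm]; ring
      · rw [if_neg (by linarith)]; ring
  · refine tendsto_card_filter_div (k₀ := k₀) (f := fun n => n - u n) ?_ fun n hn => ?_
    · exact (hnlim.sub hulim).congr fun n => by ring
    · rcases hstep n hn with ⟨e, -, h⟩ | ⟨e, -, h⟩ | ⟨e, -, h⟩ <;> simp only [h, e] <;> push_cast
      · rw [if_neg hne]; ring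
      · ring
      · rw [if_neg (by linarith)]; ring
  · refine tendsto_card_filter_div (k₀ := k₀) (f := fun n => u n + v n - n) ?_ fun n hn => ?_
    · have := (hulim.add hvlim).sub hnlim
      rw [← add_div, add_comm γ 1] at this
      exact this.congr fun n => by ring
    · rcases hstep n hn with ⟨e, e', h⟩ | ⟨e, e', h⟩ | ⟨e, e', h⟩ <;> simp only [h, e, e'] <;>
        push_cast
      · rw [if_neg (by linarith)]; ring
      · rw [if_neg (by linarith)]; ring
      · ring

/-- `x` and `x'` are conjugate elements of `ℤ[β]`. -/
def ConjPair (β β' x x' : ℝ) : Prop :=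
  ∃ u v : ℤ, x = u + v * β ∧ x' = u + v * β'

/-- `β` and `β'` are the roots of `X ^ 2 - p * X ± 1`, and `β` is a Pisot number. -/
structure IsUnitPair (β β' : ℝ) (p : ℤ) : Prop where
  one_lt : 1 < β
  irrational : Irrational β
  add_eq : β + β' = p
  mul_eq : β * β' = 1 ∨ β * β' = -1

/-- `x = ∑ dᵢ αⁱ` and `x' = ∑ dᵢ α'ⁱ` for the same finite string of digits `a ≤ dᵢ ≤ A`. -/
inductive DigitPair (α α' : ℝ) (a A : ℤ) : ℝ → ℝ → Prop
  | zero : DigitPair α α' a A 0 0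
  | step {x x' : ℝ} {d : ℤ} : DigitPair α α' a A x x' → a ≤ d → d ≤ A →
      DigitPair α α' a A (α * x + d) (α' * x' + d)

namespace IsUnitPair

variable {β β' : ℝ} {p : ℤ}

lemma pos (h : IsUnitPair β β' p) : 0 < β := one_pos.trans h.one_lt

lemma abs_conj_mul (h : IsUnitPair β β' p) : |β'| * β = 1 := by
  have e := abs_mul β β'
  rw [abs_of_pos h.pos] at e
  rw [mul_comm, ← e]
  rcases h.mul_eq with e | e <;> simp [e]

lemma abs_conj (h : IsUnitPair β β' p) : |β'| = β⁻¹ :=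
  eq_inv_of_mul_eq_one_left h.abs_conj_mul

lemma abs_conj_lt_one (h : IsUnitPair β β' p) : |β'| < 1 := by
  rw [h.abs_conj]
  exact inv_lt_one_of_one_lt₀ h.one_lt

lemma conj_ne_zero (h : IsUnitPair β β' p) : β' ≠ 0 := by
  rintro rfl
  simpa using h.abs_conj_mul

end IsUnitPair

namespace ConjPair

variable {β β' x x' y y' : ℝ} {p : ℤ}

lemma intCast (n : ℤ) : ConjPair β β' n n := ⟨n, 0, by simp, by simp⟩

lemma self : ConjPair β β' β β' := ⟨0, 1, by simp, by simp⟩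

lemma add (h : ConjPair β β' x x') (h' : ConjPair β β' y y') :
    ConjPair β β' (x + y) (x' + y') := by
  obtain ⟨u, v, rfl, rfl⟩ := h
  obtain ⟨u', v', rfl, rfl⟩ := h'
  exact ⟨u + u', v + v', by push_cast; ring, by push_cast; ring⟩

lemma neg (h : ConjPair β β' x x') : ConjPair β β' (-x) (-x') := by
  obtain ⟨u, v, rfl, rfl⟩ := h
  exact ⟨-u, -v, by push_cast; ring, by push_cast; ring⟩

lemma sub (h : ConjPair β β' x x') (h' : ConjPair β β' y y') :
    ConjPair β β' (x - y) (x' - y') := by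
  simpa only [sub_eq_add_neg] using h.add h'.neg

lemma mul (hβ : IsUnitPair β β' p) (h : ConjPair β β' x x') (h' : ConjPair β β' y y') :
    ConjPair β β' (x * y) (x' * y') := by
  obtain ⟨u, v, rfl, rfl⟩ := h
  obtain ⟨u', v', rfl, rfl⟩ := h'
  obtain rfl : β' = p - β := by linarith [hβ.add_eq]
  rcases hβ.mul_eq with e | e
  · refine ⟨u * u' - v * v', u * v' + v * u' + p * v * v', ?_, ?_⟩ <;> push_cast <;>
      linear_combination (-(v : ℝ) * v') * e
  · refine ⟨u * u' + v * v', u * v' + v * u' + p * v * v', ?_, ?_⟩ <;> push_cast <;>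
      linear_combination (-(v : ℝ) * v') * e

lemma inv_self (hβ : IsUnitPair β β' p) : ConjPair β β' β⁻¹ β'⁻¹ := by
  have h1 := hβ.pos.ne'
  have h2 := hβ.conj_ne_zero
  have h3 := hβ.add_eq
  rcases hβ.mul_eq with e | e
  · refine ⟨p, -1, inv_eq_of_mul_eq_one_right ?_, inv_eq_of_mul_eq_one_right ?_⟩ <;>
      rw [← h3, ← e] <;> push_cast <;> ring
  · refine ⟨-p, 1, inv_eq_of_mul_eq_one_right ?_, inv_eq_of_mul_eq_one_right ?_⟩ <;>
      push_cast <;> rw [← h3] <;> linarith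

lemma pow (hβ : IsUnitPair β β' p) (h : ConjPair β β' x x') (n : ℕ) :
    ConjPair β β' (x ^ n) (x' ^ n) := by
  induction n with
  | zero => simpa using intCast (β := β) (β' := β') 1
  | succ n ih => simpa only [pow_succ] using ih.mul hβ h

end ConjPair

lemma IsUnitPair.abs_conj_of_eq_or_neg {β β' α α' : ℝ} {p : ℤ} (hβ : IsUnitPair β β' p)
    (hα : α = β ∧ α' = β' ∨ α = -β ∧ α' = -β') : |α'| = β⁻¹ := by
  rw [← hβ.abs_conj]
  rcases hα with ⟨-, rfl⟩ | ⟨-, rfl⟩ <;> simp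

lemma ConjPair.of_eq_or_neg {β β' α α' : ℝ}
    (hα : α = β ∧ α' = β' ∨ α = -β ∧ α' = -β') : ConjPair β β' α α' := by
  rcases hα with ⟨rfl, rfl⟩ | ⟨rfl, rfl⟩
  · exact .self
  · exact ConjPair.self.neg

/-- The centre of the interval spanned by the conjugates of the sums with digits in `[a, A]`. -/
noncomputable def windowCenter (α' : ℝ) (a A : ℤ) : ℝ := (a + A) / (2 * (1 - α'))

/-- Half the length of the interval spanned by the conjugates of the sums with digits in
`[a, A]`. -/
noncomputable def windowRadius (β : ℝ) (a A : ℤ) : ℝ := (A - a) * β / (2 * (β - 1))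

lemma mem_XspecZ_iff {α α' x : ℝ} {a A : ℤ} (ha : a ≤ 0) (hA : 0 ≤ A) :
    x ∈ XspecZ α a A ↔ ∃ x', DigitPair α α' a A x x' := by
  constructor
  · rintro ⟨n, c, hc, rfl⟩
    induction n generalizing c with
    | zero =>
      exact ⟨c 0, by
        simpa using DigitPair.step (α := α) (α' := α') .zero (hc 0 le_rfl).1 (hc 0 le_rfl).2⟩
    | succ n ih =>
      obtain ⟨x', hx'⟩ := ih (fun j => c (j + 1)) fun j hj => hc (j + 1) (by omega)
      refine ⟨α' * x' + c 0, ?_⟩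
      convert hx'.step (hc 0 (by omega)).1 (hc 0 (by omega)).2 using 1
      rw [Finset.sum_range_succ', Finset.mul_sum]
      congr 1
      · exact Finset.sum_congr rfl fun j _ => by ring
      · simp
  · rintro ⟨x', h⟩
    induction h with
    | zero => exact ⟨0, fun _ => 0, fun _ _ => ⟨ha, hA⟩, by simp⟩
    | @step x x' d _ hd hd' ih =>
      obtain ⟨n, c, hc, rfl⟩ := ih
      refine ⟨n + 1, fun j => j.casesOn d c, fun j hj => ?_, ?_⟩
      · cases j with
        | zero => exact ⟨hd, hd'⟩
        | succ j => exact hc j (by omega)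
      · rw [Finset.sum_range_succ' _ (n + 1), Finset.mul_sum]
        congr 1
        · exact Finset.sum_congr rfl fun j _ => by simp only; ring
        · simp

namespace DigitPair

variable {α α' β β' x x' y y' : ℝ} {a A b B p : ℤ}

lemma mono (h : DigitPair α α' a A x x') (hb : b ≤ a) (hB : A ≤ B) :
    DigitPair α α' b B x x' := by
  induction h with
  | zero => exact .zero
  | step _ hd hd' ih => exact ih.step (hb.trans hd) (hd'.trans hB)

lemma neg (h : DigitPair α α' a A x x') : DigitPair α α' (-A) (-a) (-x) (-x') := by
  induction h with
  | zero => simpa using DigitPair.zero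
  | @step x x' d _ hd hd' ih =>
    convert ih.step (d := -d) (by omega) (by omega) using 1 <;> push_cast <;> ring

lemma add (h : DigitPair α α' a A x x') (h' : DigitPair α α' b B y y')
    (ha : a ≤ 0) (hA : 0 ≤ A) (hb : b ≤ 0) (hB : 0 ≤ B) :
    DigitPair α α' (a + b) (A + B) (x + y) (x' + y') := by
  induction h generalizing y y' with
  | zero => simpa using h'.mono (by omega) (by omega)
  | @step x x' d h hd hd' ih =>
    cases h' with
    | zero => simpa using (h.step hd hd').mono (b := a + b) (B := A + B) (by omega) (by omega)
    | @step y y' e h' he he' =>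
      convert (ih h').step (d := d + e) (by omega) (by omega) using 1 <;> push_cast <;> ring

lemma conjPair (h : DigitPair α α' a A x x') (hβ : IsUnitPair β β' p)
    (hα : ConjPair β β' α α') : ConjPair β β' x x' := by
  induction h with
  | zero => simpa using ConjPair.intCast (β := β) (β' := β') 0
  | step _ _ _ ih => exact (hα.mul hβ ih).add (.intCast _)

lemma nonneg (h : DigitPair α α' 0 A x x') (hα : 0 ≤ α) : 0 ≤ x := by
  induction h with
  | zero => exact le_rfl
  | step _ hd _ ih => exact add_nonneg (mul_nonneg hα ih) (by exact_mod_cast hd)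

lemma abs_sub_windowCenter_le (h : DigitPair α α' a A x x') (hβ : 1 < β)
    (hα' : |α'| = β⁻¹) (ha : a ≤ 0) (hA : 0 ≤ A) :
    |x' - windowCenter α' a A| ≤ windowRadius β a A := by
  have hα1 : |α'| < 1 := hα' ▸ inv_lt_one_of_one_lt₀ hβ
  have h1 : (1 - α') ≠ 0 := by linarith [(abs_lt.1 hα1).2]
  have hβ0 : (0 : ℝ) < β := by linarith
  have hβ1 : β - 1 ≠ 0 := by linarith
  have ha' : (a : ℝ) ≤ 0 := by exact_mod_cast ha
  have hA' : (0 : ℝ) ≤ A := by exact_mod_cast hA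
  have hrad : β⁻¹ * windowRadius β a A + (A - a) / 2 = windowRadius β a A := by
    unfold windowRadius
    field_simp
    ring
  have hcen : (1 - α') * windowCenter α' a A = (a + A) / 2 := by
    unfold windowCenter
    field_simp
  have hr0 : 0 ≤ windowRadius β a A := by
    unfold windowRadius
    exact div_nonneg (mul_nonneg (by linarith) hβ0.le) (by linarith)
  have key : ∀ y' (d : ℝ), |y' - windowCenter α' a A| ≤ windowRadius β a A → a ≤ d → d ≤ A →
      |α' * y' + d - windowCenter α' a A| ≤ windowRadius β a A := by
    intro y' d hy hd hd'
    have e : α' * y' + d - windowCenter α' a A =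
        α' * (y' - windowCenter α' a A) + (d - (a + A) / 2) := by
      rw [← hcen]; ring
    rw [e, ← hrad]
    refine (abs_add_le _ _).trans (add_le_add ?_ ?_)
    · rw [abs_mul, hα']
      exact mul_le_mul_of_nonneg_left hy (by positivity)
    · rw [abs_le]; constructor <;> linarith
  induction h with
  | zero =>
    have e : (0 : ℝ) - windowCenter α' a A =
        α' * (0 - windowCenter α' a A) + (0 - (a + A) / 2) := by rw [← hcen]; ring
    have h2 : |(0 : ℝ) - windowCenter α' a A| ≤
        β⁻¹ * |0 - windowCenter α' a A| + (A - a) / 2 := by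
      conv_lhs => rw [e]
      refine (abs_add_le _ _).trans (add_le_add ?_ ?_)
      · rw [abs_mul, hα']
      · rw [abs_le]; constructor <;> linarith
    have hb : β⁻¹ < 1 := inv_lt_one_of_one_lt₀ hβ
    nlinarith
  | step _ hd hd' ih => exact key _ _ ih (by exact_mod_cast hd) (by exact_mod_cast hd')

/-- Two sums whose conjugates almost realise the two ends of the window. -/
lemma exists_wide (hβ : 1 < β) (hα' : |α'| = β⁻¹) (hab : a < A) {δ : ℝ} (hδ : 0 < δ) :
    ∃ w w' v v', DigitPair α α' a A w w' ∧ DigitPair α α' a A v v' ∧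
      w' - v' < 2 * windowRadius β a A ∧ 2 * windowRadius β a A - δ ≤ w' - v' := by
  have hβ0 : (0 : ℝ) < β := by linarith
  have hβ1 : β - 1 ≠ 0 := by linarith
  have hab' : (a : ℝ) < A := by exact_mod_cast hab
  have hr : 0 < 2 * windowRadius β a A := by
    have : 0 < β - 1 := by linarith
    have : 0 < (A : ℝ) - a := by linarith
    unfold windowRadius
    positivity
  have hrad : β⁻¹ * (2 * windowRadius β a A) + (A - a) = 2 * windowRadius β a A := by
    unfold windowRadius
    field_simp
    ring
  have key : ∀ n : ℕ, ∃ w w' v v', DigitPair α α' a A w w' ∧ DigitPair α α' a A v v' ∧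
      w' - v' = 2 * windowRadius β a A * (1 - β⁻¹ ^ n) := by
    intro n
    induction n with
    | zero => exact ⟨0, 0, 0, 0, .zero, .zero, by simp⟩
    | succ n ih =>
      obtain ⟨w, w', v, v', hw, hv, e⟩ := ih
      rcases abs_cases α' with ⟨h, -⟩ | ⟨h, -⟩
      · refine ⟨_, _, _, _, hw.step hab.le le_rfl, hv.step le_rfl hab.le, ?_⟩
        have : α' = β⁻¹ := by linarith
        rw [this, pow_succ]
        linear_combination β⁻¹ * e + hrad
      · refine ⟨_, _, _, _, hv.step hab.le le_rfl, hw.step le_rfl hab.le, ?_⟩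
        have : α' = -β⁻¹ := by linarith
        rw [this, pow_succ]
        linear_combination β⁻¹ * e + hrad
  obtain ⟨n, hn⟩ := exists_pow_lt_of_lt_one (div_pos hδ hr) (inv_lt_one_of_one_lt₀ hβ)
  obtain ⟨w, w', v, v', hw, hv, e⟩ := key n
  refine ⟨w, w', v, v', hw, hv, ?_, ?_⟩ <;> rw [e]
  · have : 0 < β⁻¹ ^ n := by positivity
    nlinarith
  · rw [lt_div_iff₀ hr] at hn
    linarith

end DigitPair

/-- Every conjugate pair `(x, x')` with `x` large and `x'` inside the window of the alphabet
`[a, A]` is represented with digits in `[a, A]`. -/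
def FillsWindow (β β' α α' : ℝ) (a A : ℤ) : Prop :=
  ∀ ε > 0, ∃ R : ℝ, ∀ x x', ConjPair β β' x x' → R ≤ x →
    |x' - windowCenter α' a A| ≤ windowRadius β a A - ε → DigitPair α α' a A x x'

lemma windowCenter_add (α' : ℝ) (a A b B : ℤ) :
    windowCenter α' (a + b) (A + B) = windowCenter α' a A + windowCenter α' b B := by
  unfold windowCenter
  push_cast
  ring

lemma windowRadius_add (β : ℝ) (a A b B : ℤ) :
    windowRadius β (a + b) (A + B) = windowRadius β a A + windowRadius β b B := by
  unfold windowRadius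
  push_cast
  ring

theorem FillsWindow.add {β β' α α' : ℝ} {p a A b B : ℤ} (hβ : IsUnitPair β β' p)
    (hα : ConjPair β β' α α') (hα' : |α'| = β⁻¹) (h : FillsWindow β β' α α' a A)
    (ha : a ≤ 0) (hA : 0 ≤ A) (hb : b ≤ 0) (hB : 0 ≤ B) (hlt : b < B) (hle : B - b ≤ A - a) :
    FillsWindow β β' α α' (a + b) (A + B) := by
  intro ε hε
  have hβ1 := hβ.one_lt
  obtain ⟨w, w', v, v', hw, hv, h1, h2⟩ :=
    DigitPair.exists_wide (α := α) hβ1 hα' hlt (half_pos hε)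
  have hrad : windowRadius β b B ≤ windowRadius β a A := by
    unfold windowRadius
    have : (B : ℝ) - b ≤ A - a := by exact_mod_cast hle
    have : 0 < 2 * (β - 1) := by linarith
    have := hβ.pos
    gcongr
  obtain ⟨hw1, hw2⟩ := abs_le.1 (hw.abs_sub_windowCenter_le hβ1 hα' hb hB)
  obtain ⟨hv1, hv2⟩ := abs_le.1 (hv.abs_sub_windowCenter_le hβ1 hα' hb hB)
  set δ := min (ε / 2) ((2 * windowRadius β a A - (w' - v')) / 2) with hδ
  have hδ0 : 0 < δ := lt_min (by linarith) (by linarith)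
  have hδ1 : δ ≤ ε / 2 := min_le_left _ _
  have hδ2 : δ ≤ (2 * windowRadius β a A - (w' - v')) / 2 := min_le_right _ _
  obtain ⟨R, hR⟩ := h δ hδ0
  refine ⟨max (R + w) (R + v), fun x x' hx hRx hx' => ?_⟩
  rw [windowCenter_add, windowRadius_add] at hx'
  obtain ⟨hx1, hx2⟩ := abs_le.1 hx'
  have hRw := (le_max_left _ _).trans hRx
  have hRv := (le_max_right _ _).trans hRx
  rcases le_or_gt x' (windowCenter α' a A + windowRadius β a A - δ + v') with hc | hc
  · have := (hR (x - v) (x' - v') (hx.sub (hv.conjPair hβ hα)) (by linarith)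
      (abs_le.2 ⟨by linarith, by linarith⟩)).add hv ha hA hb hB
    simpa using this
  · have := (hR (x - w) (x' - w') (hx.sub (hw.conjPair hβ hα)) (by linarith)
      (abs_le.2 ⟨by linarith, by linarith⟩)).add hw ha hA hb hB
    simpa using this

/-- Repeated extension of the alphabet to the right and to the left. -/
theorem FillsWindow.mono {β β' α α' : ℝ} {p a A b B : ℤ} (hβ : IsUnitPair β β' p)
    (hα : ConjPair β β' α α') (hα' : |α'| = β⁻¹) (h : FillsWindow β β' α α' a A)
    (ha : a ≤ 0) (hA : 0 ≤ A) (hlt : a < A) (hb : b ≤ a) (hB : A ≤ B) :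
    FillsWindow β β' α α' b B := by
  have right : ∀ n : ℕ, FillsWindow β β' α α' a (A + n) := by
    intro n
    induction n with
    | zero => simpa using h
    | succ n ih =>
      simpa [add_assoc] using ih.add (b := 0) (B := 1) hβ hα hα' ha (by omega) le_rfl
        zero_le_one zero_lt_one (by omega)
  have left : ∀ n : ℕ, FillsWindow β β' α α' (a - n) B := by
    intro n
    induction n with
    | zero =>
      have := right (B - A).toNat
      rw [show A + ((B - A).toNat : ℤ) = B by omega] at this
      simpa using this
    | succ n ih =>
      have := ih.add (b := -1) (B := 0) hβ hα hα' (by omega) (by omega) (by omega)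
        le_rfl (by omega) (by omega)
      simpa [show a - (n + 1 : ℤ) = a - n + -1 by ring] using this
  have := left (a - b).toNat
  rwa [show a - ((a - b).toNat : ℤ) = b by omega] at this

/-- The sum of `n` digits which shifts expansions with digits in `[0, A - a]`
and base `β` to expansions with digits in `[a, A]` and base `α = ±β`. -/
noncomputable def digitShift (β α : ℝ) (a A : ℤ) (n : ℕ) : ℝ :=
  (a + A) / 2 * ∑ i ∈ Finset.range n, α ^ i - (A - a) / 2 * ∑ i ∈ Finset.range n, β ^ i

lemma digitShift_self_succ (β : ℝ) (a A : ℤ) (n : ℕ) :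
    digitShift β β a A (n + 1) = β * digitShift β β a A n + a := by
  unfold digitShift
  rw [geom_sum_succ]
  ring

lemma digitShift_neg_succ (β : ℝ) (a A : ℤ) (n : ℕ) :
    digitShift β (-β) a A (n + 1) = β * digitShift β (-β) (-A) (-a) n + a := by
  unfold digitShift
  rw [geom_sum_succ, geom_sum_succ]
  push_cast
  ring

namespace DigitPair

variable {β β' α α' t t' : ℝ} {a A m : ℤ} {n : ℕ}

lemma eq_zero_of_lt_one (h : DigitPair β β' 0 m t t') (hβ : 1 < β) (ht : t < 1) :
    t = 0 ∧ t' = 0 := by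
  induction h with
  | zero => exact ⟨rfl, rfl⟩
  | @step x x' d h hd _ ih =>
    have hx := h.nonneg (by linarith)
    have hd0 : d = 0 := by
      by_contra hne
      have : (1 : ℝ) ≤ d := by exact_mod_cast (by omega : 1 ≤ d)
      nlinarith
    subst hd0
    obtain ⟨rfl, rfl⟩ := ih (by push_cast at ht; nlinarith)
    simp

lemma add_digitShift (hβ : 1 < β) (ha : a ≤ A) (hα : α = β ∧ α' = β' ∨ α = -β ∧ α' = -β')
    (h : DigitPair β β' 0 (A - a) t t') (ht : t < β ^ n) :
    DigitPair α α' a A (t + digitShift β α a A n) (t' + digitShift β' α' a A n) := by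
  have hβ0 : 0 < β := by linarith
  induction n generalizing t t' a A with
  | zero =>
    obtain ⟨rfl, rfl⟩ := h.eq_zero_of_lt_one hβ (by simpa using ht)
    simpa [digitShift] using DigitPair.zero
  | succ n ih =>
    obtain ⟨s, s', d, hs, hd, hd', rfl, rfl⟩ : ∃ s s', ∃ d : ℤ, DigitPair β β' 0 (A - a) s s' ∧
        0 ≤ d ∧ d ≤ A - a ∧ t = β * s + d ∧ t' = β' * s' + d := by
      cases h with
      | zero => exact ⟨0, 0, 0, .zero, le_rfl, by omega, by simp, by simp⟩
      | step h hd hd' => exact ⟨_, _, _, h, hd, hd', rfl, rfl⟩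
    have hd0 : (0 : ℝ) ≤ d := by exact_mod_cast hd
    have hsn : s < β ^ n := by
      rw [pow_succ'] at ht
      exact lt_of_mul_lt_mul_left (by linarith) hβ0.le
    rcases hα with ⟨rfl, rfl⟩ | ⟨rfl, rfl⟩
    · convert (ih ha hs hsn).step (d := d + a) (by omega) (by omega) using 1 <;>
        rw [digitShift_self_succ] <;> push_cast <;> ring
    · have h := (ih (a := -A) (A := -a) (by omega)
        (by rwa [show -a - -A = A - a by ring]) hsn).neg
      rw [neg_neg, neg_neg] at h
      convert h.step (d := d + a) (by omega) (by omega) using 1 <;>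
        rw [digitShift_neg_succ] <;> push_cast <;> ring

end DigitPair

lemma tendsto_digitShift {β' α' : ℝ} (hβ' : |β'| < 1) (hα' : |α'| < 1) (a A : ℤ) :
    Tendsto (digitShift β' α' a A) atTop
      (𝓝 (windowCenter α' a A - windowCenter β' 0 (A - a))) := by
  have h1 := (hasSum_geometric_of_abs_lt_one hα').tendsto_sum_nat.const_mul (((a : ℝ) + A) / 2)
  have h2 := (hasSum_geometric_of_abs_lt_one hβ').tendsto_sum_nat.const_mul (((A : ℝ) - a) / 2)
  have h3 : 1 - α' ≠ 0 := by linarith [(abs_lt.1 hα').2]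
  have h4 : 1 - β' ≠ 0 := by linarith [(abs_lt.1 hβ').2]
  have e : windowCenter α' a A - windowCenter β' 0 (A - a) =
      ((a : ℝ) + A) / 2 * (1 - α')⁻¹ - ((A : ℝ) - a) / 2 * (1 - β')⁻¹ := by
    unfold windowCenter
    push_cast
    field_simp
    ring
  rw [e]
  exact h1.sub h2

lemma digitShift_nonpos {β α : ℝ} (hα : |α| = β) {a A : ℤ} (ha : a ≤ 0)
    (hA : 0 ≤ A) (n : ℕ) : digitShift β α a A n ≤ 0 := by
  have ha' : (a : ℝ) ≤ 0 := by exact_mod_cast ha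
  have hA' : (0 : ℝ) ≤ A := by exact_mod_cast hA
  have h1 : |∑ i ∈ Finset.range n, α ^ i| ≤ ∑ i ∈ Finset.range n, β ^ i := by
    refine (Finset.abs_sum_le_sum_abs _ _).trans_eq (Finset.sum_congr rfl fun i _ => ?_)
    rw [abs_pow, hα]
  have h2 : |((a : ℝ) + A) / 2| ≤ (A - a) / 2 := abs_le.2 ⟨by linarith, by linarith⟩
  have h3 := mul_le_mul h2 h1 (abs_nonneg _) (by linarith)
  rw [← abs_mul] at h3
  unfold digitShift
  linarith [le_abs_self (((a : ℝ) + A) / 2 * ∑ i ∈ Finset.range n, α ^ i)]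

theorem FillsWindow.of_frequently {β β' α α' : ℝ} {p a A : ℤ} (hβ : IsUnitPair β β' p)
    (hα : α = β ∧ α' = β' ∨ α = -β ∧ α' = -β') (ha : a ≤ 0) (hA : 0 ≤ A)
    (h : FillsWindow β β' β β' 0 (A - a))
    (hf : ∀ x : ℝ, ∃ᶠ n in atTop, x - digitShift β α a A n < β ^ n) :
    FillsWindow β β' α α' a A := by
  intro ε hε
  obtain ⟨R, hR⟩ := h (ε / 2) (half_pos hε)
  refine ⟨R, fun x x' hx hRx hx' => ?_⟩
  have hα1 : |α'| < 1 := by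
    rw [hβ.abs_conj_of_eq_or_neg hα]
    exact inv_lt_one_of_one_lt₀ hβ.one_lt
  have hα2 : |α| = β := by
    rcases hα with ⟨rfl, -⟩ | ⟨rfl, -⟩ <;> simp [abs_of_pos hβ.pos]
  have hα3 := ConjPair.of_eq_or_neg hα
  have hlim := (tendsto_digitShift hβ.abs_conj_lt_one hα1 a A)
  obtain ⟨n, hn, hn'⟩ := ((hf x).and_eventually
    (hlim.eventually (Metric.ball_mem_nhds _ (half_pos hε)))).exists
  rw [Real.dist_eq] at hn'
  have hs : DigitPair α α' a A (digitShift β α a A n) (digitShift β' α' a A n) := by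
    simpa using (DigitPair.zero (α := β) (α' := β') (a := 0) (A := A - a)).add_digitShift
      hβ.one_lt (ha.trans hA) hα (n := n) (pow_pos hβ.pos n)
  have hrad : windowRadius β 0 (A - a) = windowRadius β a A := by
    unfold windowRadius; push_cast; ring
  have ht := hR (x - digitShift β α a A n) (x' - digitShift β' α' a A n)
    (hx.sub (hs.conjPair hβ hα3))
    (by linarith [digitShift_nonpos hα2 ha hA n]) (by
      rw [hrad]
      rw [abs_lt] at hn'
      rw [abs_le] at hx' ⊢
      constructor <;> linarith)
  simpa using ht.add_digitShift hβ.one_lt (ha.trans hA) hα hn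

/-- If the shift grows like `-θ * β ^ n` with `θ < 1` along a subsequence, it is eventually
smaller than `β ^ n` there. -/
lemma exists_forall_add_mul_pow_lt {β θ : ℝ} (hβ : 1 < β) (hθ : θ < 1) (x : ℝ) :
    ∃ N : ℕ, ∀ n ≥ N, x + θ * β ^ n < β ^ n := by
  have h : Tendsto (fun n : ℕ => (1 - θ) * β ^ n) atTop atTop :=
    (tendsto_pow_atTop_atTop_of_one_lt hβ).const_mul_atTop (by linarith)
  obtain ⟨N, hN⟩ := (h.eventually_gt_atTop x).exists_forall_of_atTop
  exact ⟨N, fun n hn => by linarith [hN n hn]⟩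

lemma frequently_sub_digitShift_self_lt {β : ℝ} (hβ : 1 < β) {a A : ℤ} (hA : 1 ≤ A)
    (hm : (A : ℝ) - a < β) (x : ℝ) : ∃ᶠ n in atTop, x - digitShift β β a A n < β ^ n := by
  have h1 : 0 < β - 1 := by linarith
  have hA' : (1 : ℝ) ≤ A := by exact_mod_cast hA
  obtain ⟨N, hN⟩ := exists_forall_add_mul_pow_lt hβ (θ := -a / (β - 1))
    (by rw [div_lt_one h1]; linarith) (x + a / (β - 1))
  refine (eventually_atTop.2 ⟨N, fun n hn => ?_⟩).frequently
  convert hN n hn using 1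
  unfold digitShift
  rw [geom_sum_eq hβ.ne']
  field_simp
  ring

lemma frequently_sub_digitShift_neg_lt {β : ℝ} (hβ : 1 < β) (hβ2 : 2 < β ^ 2) {a A : ℤ}
    (ha : a ≤ 0) (hA : 0 ≤ A) (hm : (A : ℝ) - a < β) (hm' : β - 1 < (A : ℝ) - a) (x : ℝ) :
    ∃ᶠ n in atTop, x - digitShift β (-β) a A n < β ^ n := by
  have h1 : 0 < β - 1 := by linarith
  have h2 : 0 < β + 1 := by linarith
  have hθ : (A - a) / 2 / (β - 1) - |(a : ℝ) + A| / 2 / (β + 1) < 1 := by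
    rcases le_or_gt 2 β with h | h
    · have : (A - a) / 2 / (β - 1) < 1 := by rw [div_lt_one h1]; linarith
      have : 0 ≤ |(a : ℝ) + A| / 2 / (β + 1) := by positivity
      linarith
    · have h3 : A - a < 2 := by
        have : (A : ℝ) - a < (2 : ℤ) := by push_cast; linarith
        exact_mod_cast this
      have h4 : 0 < A - a := by
        have : ((0 : ℤ) : ℝ) < A - a := by push_cast; linarith
        exact_mod_cast this
      have h5 : |(a : ℝ) + A| = 1 := by
        obtain ⟨rfl, rfl⟩ | ⟨rfl, rfl⟩ : (a = 0 ∧ A = 1) ∨ (a = -1 ∧ A = 0) := by omega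
        all_goals norm_num
      have h6 : (A : ℝ) - a = 1 := by exact_mod_cast (by omega : A - a = 1)
      rw [h5, h6, div_sub_div _ _ h1.ne' h2.ne', div_lt_one (by positivity)]
      nlinarith
  have key : ∀ n : ℕ, ((a : ℝ) + A) * (-1) ^ n = -|(a : ℝ) + A| →
      x - digitShift β (-β) a A n = x - (A - a) / 2 / (β - 1) - (a + A) / 2 / (β + 1) +
        ((A - a) / 2 / (β - 1) - |(a : ℝ) + A| / 2 / (β + 1)) * β ^ n := by
    intro n hn
    unfold digitShift
    rw [geom_sum_eq hβ.ne', geom_sum_eq (by linarith : -β ≠ 1), neg_pow,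
      show -β - 1 = -(β + 1) by ring]
    field_simp
    linear_combination (β ^ n * (β - 1)) * hn
  obtain ⟨N, hN⟩ := exists_forall_add_mul_pow_lt hβ hθ
    (x - (A - a) / 2 / (β - 1) - (a + A) / 2 / (β + 1))
  rw [frequently_atTop]
  intro M
  rcases le_total ((a : ℝ) + A) 0 with h | h
  · refine ⟨2 * max M N, by omega, ?_⟩
    rw [key _ (by rw [pow_mul, abs_of_nonpos h]; simp)]
    exact hN _ (by omega)
  · refine ⟨2 * max M N + 1, by omega, ?_⟩
    rw [key _ (by rw [pow_succ, pow_mul, abs_of_nonneg h]; simp)]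
    exact hN _ (by omega)

namespace DigitPair

variable {β β' x x' : ℝ} {p : ℤ}

lemma of_conjPair_of_mul_eq_neg_one (hβ : 1 < β) (hp : 1 ≤ p) (hadd : β + β' = p)
    (hmul : β * β' = -1) (N : ℕ) (h : ConjPair β β' x x') (h0 : 0 ≤ x) (hN : x < β ^ N)
    (h1 : -1 < x') (h2 : x' < β) : DigitPair β β' 0 p x x' := by
  have hb0 : β' < 0 := by nlinarith
  have hb1 : -1 < β' := by nlinarith
  induction N generalizing x x' with
  | zero =>
    obtain ⟨u, v, rfl, rfl⟩ := h
    rw [pow_zero] at hN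
    have hv : v = 0 := by
      have hv1 : v < 1 := by
        by_contra! hc
        have : (1 : ℝ) ≤ v := by exact_mod_cast hc
        nlinarith
      have hv2 : -1 < v := by
        by_contra! hc
        have : (v : ℝ) ≤ -1 := by exact_mod_cast hc
        nlinarith
      omega
    subst hv
    have hu1 : u < 1 := by
      have : (u : ℝ) < 1 := by simpa using hN
      exact_mod_cast this
    have hu2 : 0 ≤ u := by
      have : (0 : ℝ) ≤ u := by simpa using h0
      exact_mod_cast this
    obtain rfl : u = 0 := by omega
    simpa using DigitPair.zero
  | succ N ih =>
    have hβ0 : 0 < β := by linarith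
    obtain ⟨d, hd0, hdp, hd1, hd2⟩ : ∃ d : ℤ, 0 ≤ d ∧ d ≤ p ∧ -1 < x' - d ∧ x' - d < -β' := by
      have hc0 : 0 ≤ ⌈x'⌉ := by
        have : -1 < ⌈x'⌉ := Int.lt_ceil.2 (by push_cast; exact h1)
        omega
      rcases le_or_gt ⌈x'⌉ p with hc | hc
      · exact ⟨⌈x'⌉, hc0, hc, by linarith [Int.ceil_lt_add_one x'],
          by linarith [Int.le_ceil x']⟩
      · have := Int.lt_ceil.1 hc
        exact ⟨p, by omega, le_rfl, by linarith, by linarith⟩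
    obtain ⟨y, y', hy, rfl, rfl⟩ : ∃ y y', ConjPair β β' y y' ∧ x = β * y + d ∧
        x' = β' * y' + d := by
      obtain ⟨u, v, rfl, rfl⟩ := h
      refine ⟨v + (u - d) * (-β'), v + (u - d) * (-β),
        ⟨v - p * (u - d), u - d, by push_cast; rw [← hadd]; ring,
          by push_cast; rw [← hadd]; ring⟩, ?_, ?_⟩ <;>
        linear_combination ((u : ℝ) - d) * hmul
    have hy1 : -1 < y' := by nlinarith
    have hy2 : y' < β := by nlinarith
    have hdp' : (d : ℝ) ≤ p := by exact_mod_cast hdp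
    have hyN : y < β ^ N := by
      have : (0 : ℝ) ≤ d := by exact_mod_cast hd0
      rw [pow_succ'] at hN
      exact lt_of_mul_lt_mul_left (by linarith) hβ0.le
    refine (ih hy ?_ hyN hy1 hy2).step hd0 hdp
    by_contra! hneg
    have hy3 : -1 < y := by nlinarith
    obtain ⟨u, v, rfl, rfl⟩ := hy
    have hv1 : v < 1 := by
      by_contra! hc
      have : (1 : ℝ) ≤ v := by exact_mod_cast hc
      nlinarith
    have hv2 : -2 < v := by
      by_contra! hc
      have : (v : ℝ) ≤ -2 := by exact_mod_cast hc
      nlinarith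
    obtain rfl | rfl : v = 0 ∨ v = -1 := by omega
    · have e1 : u < 0 := by
        have : (u : ℝ) < 0 := by simpa using hneg
        exact_mod_cast this
      have e2 : -1 < u := by
        have : (-1 : ℝ) < u := by simpa using hy3
        exact_mod_cast this
      omega
    · push_cast at hneg hy3 hy2
      have e1 : u < p + 1 := by
        have : (u : ℝ) < p + 1 := by linarith
        exact_mod_cast this
      have e2 : p - 1 < u := by
        have : (p : ℝ) - 1 < u := by linarith
        exact_mod_cast this
      obtain rfl : u = p := by omega
      linarith

/-- The digit sums avoiding both boundary points of the window, apart from the pairs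
`(β' + β + ⋯ + β ^ k, β + β' + ⋯ + β' ^ k)`. -/
lemma of_conjPair_of_mul_eq_one (hβ : 5 / 2 < β) (hp : 3 ≤ p) (hadd : β + β' = p)
    (hmul : β * β' = 1) {c : ℝ} (hc : c * (β - 1) = (p - 1) * β) (N : ℕ)
    (h : ConjPair β β' x x') (h0 : 0 < x) (hN : x < β ^ N) (h1 : 0 < x') (h2 : x' < c) :
    DigitPair β β' 0 (p - 1) x x' ∨ ∃ k : ℕ,
      x = β' + β * ∑ i ∈ Finset.range k, β ^ i ∧
      x' = β + β' * ∑ i ∈ Finset.range k, β' ^ i := by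
  have hb0 : 0 < β' := by nlinarith
  have hb1 : β' < 2 / 5 := by nlinarith
  have hcβ : β < c := by nlinarith
  have hcβ' : c < β + 2 / 3 := by nlinarith
  have hc' : c = β' * c + (p - 1) := by
    have : β * c = β * (β' * c + (p - 1)) := by linear_combination hc - c * hmul
    exact mul_left_cancel₀ (by linarith) this
  induction N generalizing x x' with
  | zero =>
    obtain ⟨u, v, rfl, rfl⟩ := h
    rw [pow_zero] at hN
    have hv1 : v < 1 := by
      by_contra! hc
      have : (1 : ℝ) ≤ v := by exact_mod_cast hc
      nlinarith
    have hv2 : -2 < v := by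
      by_contra! hc
      have : (v : ℝ) ≤ -2 := by exact_mod_cast hc
      nlinarith
    obtain rfl | rfl : v = 0 ∨ v = -1 := by omega
    · have e1 : 0 < u := by
        have : (0 : ℝ) < u := by simpa using h0
        exact_mod_cast this
      have e2 : u < 1 := by
        have : (u : ℝ) < 1 := by simpa using hN
        exact_mod_cast this
      omega
    · push_cast at h0 hN h1 h2 ⊢
      have e1 : p - 1 < u := by
        have : (p : ℝ) - 1 < u := by linarith
        exact_mod_cast this
      have e2 : u < p + 1 := by
        have : (u : ℝ) < p + 1 := by linarith
        exact_mod_cast this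
      obtain rfl : u = p := by omega
      exact Or.inr ⟨0, by simp; linarith, by simp; linarith⟩
  | succ N ih =>
    have hβ0 : 0 < β := by linarith
    obtain ⟨d, hd0, hdp, hd1, hd2⟩ : ∃ d : ℤ, 0 ≤ d ∧ d ≤ p - 1 ∧ 0 < x' - d ∧
        x' - d < β' * c := by
      have hc0 : 0 < ⌈x'⌉ := Int.lt_ceil.2 (by simpa using h1)
      rcases le_or_gt ⌈x'⌉ p with hle | hlt
      · refine ⟨⌈x'⌉ - 1, by omega, by omega, ?_, ?_⟩ <;> push_cast
        · linarith [Int.ceil_lt_add_one x']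
        · nlinarith [Int.le_ceil x']
      · have := Int.lt_ceil.1 hlt
        exact ⟨p - 1, by omega, le_rfl, by push_cast; linarith, by push_cast; linarith⟩
    obtain ⟨y, y', hy, rfl, rfl⟩ : ∃ y y', ConjPair β β' y y' ∧ x = β * y + d ∧
        x' = β' * y' + d := by
      obtain ⟨u, v, rfl, rfl⟩ := h
      refine ⟨v + (u - d) * β', v + (u - d) * β,
        ⟨v + p * (u - d), -(u - d), by push_cast; rw [← hadd]; ring,
          by push_cast; rw [← hadd]; ring⟩, ?_, ?_⟩ <;>
        linear_combination (-((u : ℝ) - d)) * hmul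
    have hy1 : 0 < y' := pos_of_mul_pos_right (by linarith) hb0.le
    have hy2 : y' < c := lt_of_mul_lt_mul_left (by linarith) hb0.le
    have hdp' : (d : ℝ) ≤ p - 1 := by exact_mod_cast hdp
    have hyN : y < β ^ N := by
      have : (0 : ℝ) ≤ d := by exact_mod_cast hd0
      rw [pow_succ'] at hN
      exact lt_of_mul_lt_mul_left (by linarith) hβ0.le
    rcases lt_or_ge 0 y with hpos | hneg
    · rcases ih hy hpos hyN hy1 hy2 with h | ⟨k, rfl, rfl⟩
      · exact Or.inl (h.step hd0 hdp)
      · rcases eq_or_lt_of_le hdp with rfl | hlt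
        · refine Or.inr ⟨k + 1, ?_, ?_⟩ <;> rw [geom_sum_succ] <;> push_cast <;>
            linear_combination hmul - hadd
        · left
          have hG : DigitPair β β' 0 (p - 1) (∑ i ∈ Finset.range k, β ^ i)
              (∑ i ∈ Finset.range k, β' ^ i) := by
            clear * - hp
            induction k with
            | zero => simpa using DigitPair.zero
            | succ k ih =>
              rw [geom_sum_succ, geom_sum_succ]
              simpa using ih.step (d := 1) (by omega) (by omega)
          convert (hG.step (d := 0) le_rfl (by omega)).step (d := 1 + d) (by omega)
            (by omega) using 1 <;> push_cast <;> linear_combination hmul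
    · have hy3 : -1 < y := by nlinarith
      obtain ⟨u, v, rfl, rfl⟩ := hy
      have hv1 : v < 1 := by
        by_contra! hc
        have : (1 : ℝ) ≤ v := by exact_mod_cast hc
        nlinarith
      have hv2 : -2 < v := by
        by_contra! hc
        have : (v : ℝ) ≤ -2 := by exact_mod_cast hc
        nlinarith
      obtain rfl | rfl : v = 0 ∨ v = -1 := by omega
      · have e1 : 0 < u := by
          have : (0 : ℝ) < u := by simpa using hy1
          exact_mod_cast this
        have e2 : u ≤ 0 := by
          have : (u : ℝ) ≤ 0 := by simpa using hneg
          exact_mod_cast this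
        omega
      · push_cast at hneg hy3 h0 ⊢
        have e1 : u < p := by
          have : (u : ℝ) < p := by linarith
          exact_mod_cast this
        have e2 : p - 2 < u := by
          have : (p : ℝ) - 2 < u := by linarith
          exact_mod_cast this
        obtain rfl : u = p - 1 := by omega
        have e3 : p - 2 < d := by
          have : (p : ℝ) - 2 < d := by push_cast at h0; nlinarith
          exact_mod_cast this
        obtain rfl : d = p - 1 := by omega
        refine Or.inr ⟨0, ?_, ?_⟩ <;> push_cast
        · rw [← hadd]
          simp only [Finset.range_zero, Finset.sum_empty, mul_zero, add_zero]
          linear_combination hmul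
        · rw [← hadd]
          simp only [Finset.range_zero, Finset.sum_empty, mul_zero, add_zero]
          linear_combination hmul

end DigitPair

lemma fillsWindow_of_mul_eq_neg_one {β β' : ℝ} {p : ℤ} (hβ : 1 < β) (hp : 1 ≤ p)
    (hadd : β + β' = p) (hmul : β * β' = -1) : FillsWindow β β' β β' 0 p := by
  intro ε hε
  refine ⟨0, fun x x' hx hRx hx' => ?_⟩
  obtain ⟨N, hN⟩ := pow_unbounded_of_one_lt x hβ
  have hb0 : β' < 0 := by nlinarith
  have hcen : windowCenter β' 0 p = (β - 1) / 2 := by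
    unfold windowCenter
    rw [div_eq_div_iff (by linarith) two_ne_zero, ← hadd]
    push_cast
    linear_combination 2 * hmul
  have hrad : windowRadius β 0 p = (β + 1) / 2 := by
    unfold windowRadius
    rw [div_eq_div_iff (by linarith) two_ne_zero, ← hadd]
    push_cast
    linear_combination 2 * hmul
  rw [hcen, hrad] at hx'
  obtain ⟨h1, h2⟩ := abs_le.1 hx'
  exact .of_conjPair_of_mul_eq_neg_one hβ hp hadd hmul N hx hRx hN (by linarith) (by linarith)

lemma fillsWindow_of_mul_eq_one {β β' : ℝ} {p : ℤ} (hβ : 1 < β) (hp : 3 ≤ p)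
    (hadd : β + β' = p) (hmul : β * β' = 1) : FillsWindow β β' β β' 0 (p - 1) := by
  intro ε hε
  have hb0 : 0 < β' := by nlinarith
  have hb1 : β' < 1 := by nlinarith
  have hβ' : 5 / 2 < β := by
    have : (3 : ℝ) ≤ p := by exact_mod_cast hp
    by_contra! hc
    nlinarith
  obtain ⟨c, hc⟩ : ∃ c : ℝ, c * (β - 1) = (p - 1) * β :=
    ⟨_, div_mul_cancel₀ _ (by linarith)⟩
  have hrad : windowRadius β 0 (p - 1) = c / 2 := by
    unfold windowRadius
    rw [div_eq_div_iff (by linarith) two_ne_zero]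
    push_cast
    linear_combination -2 * hc
  have hcen : windowCenter β' 0 (p - 1) = c / 2 := by
    unfold windowCenter
    rw [div_eq_div_iff (by linarith) two_ne_zero]
    push_cast
    linear_combination (-2 * β') * hc + (2 * c - 2 * (p - 1)) * hmul
  have hcβ : β < c := by nlinarith
  obtain ⟨K, hK⟩ := exists_pow_lt_of_lt_one (div_pos hε (sub_pos.2 hcβ)) hb1
  rw [lt_div_iff₀ (sub_pos.2 hcβ)] at hK
  have hc' : c = β' * c + (p - 1) := by
    have : β * c = β * (β' * c + (p - 1)) := by linear_combination hc - c * hmul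
    exact mul_left_cancel₀ (by linarith) this
  have hG : ∀ k : ℕ, c - (β + β' * ∑ i ∈ Finset.range k, β' ^ i) = β' ^ k * (c - β) := by
    intro k
    induction k with
    | zero => simp
    | succ k ih =>
      rw [geom_sum_succ, pow_succ']
      linear_combination β' * ih + hc' - hadd + hmul
  refine ⟨max (β' + β * ∑ i ∈ Finset.range K, β ^ i + 1) 1, fun x x' hx hRx hx' => ?_⟩
  have hR1 := (le_max_left _ _).trans hRx
  have hR2 := (le_max_right _ _).trans hRx
  obtain ⟨N, hN⟩ := pow_unbounded_of_one_lt x hβ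
  rw [hcen, hrad] at hx'
  obtain ⟨h1, h2⟩ := abs_le.1 hx'
  rcases DigitPair.of_conjPair_of_mul_eq_one hβ' hp hadd hmul hc N hx (by linarith) hN
    (by linarith) (by linarith) with h | ⟨k, rfl, rfl⟩
  · exact h
  · exfalso
    have hk := hG k
    rcases le_or_gt K k with hle | hlt
    · have := pow_le_pow_of_le_one hb0.le hb1.le hle
      nlinarith
    · have h3 : ∑ i ∈ Finset.range k, β ^ i ≤ ∑ i ∈ Finset.range K, β ^ i :=
        Finset.sum_le_sum_of_subset_of_nonneg (Finset.range_mono hlt.le)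
          fun i _ _ => by positivity
      nlinarith

lemma irrational_of_add_eq_of_mul_eq {β β' : ℝ} {p : ℤ} (hβ : 1 < β) (hadd : β + β' = p)
    (hmul : β * β' = 1 ∨ β * β' = -1) : Irrational β := by
  rintro ⟨q, rfl⟩
  have hq : IsIntegral ℤ q := by
    obtain ⟨e, he⟩ : ∃ e : ℤ, (q : ℝ) * β' = e := by
      rcases hmul with h | h
      · exact ⟨1, by simpa using h⟩
      · exact ⟨-1, by simpa using h⟩
    refine ⟨Polynomial.X ^ 2 - Polynomial.C p * Polynomial.X + Polynomial.C e, by monicity!, ?_⟩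
    have : (q : ℝ) ^ 2 - p * q + e = 0 := by rw [← hadd, ← he]; ring
    simp only [Polynomial.eval₂_add, Polynomial.eval₂_sub, Polynomial.eval₂_mul,
      Polynomial.eval₂_pow, Polynomial.eval₂_X, Polynomial.eval₂_C]
    simp only [eq_intCast]
    exact_mod_cast this
  obtain ⟨n, rfl⟩ := IsIntegrallyClosed.isIntegral_iff.1 hq
  simp only [eq_intCast, Rat.cast_intCast] at hβ hadd hmul
  obtain rfl : β' = ((p - n : ℤ) : ℝ) := by push_cast; linarith
  have hn : 1 < n := by exact_mod_cast hβ
  have h : n * (p - n) = 1 ∨ n * (p - n) = -1 := by exact_mod_cast hmul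
  have hu : IsUnit n := by
    rcases h with h | h
    · exact IsUnit.of_mul_eq_one _ h
    · exact IsUnit.of_mul_eq_one (-(p - n)) (by linarith)
  rcases Int.isUnit_iff.1 hu with h | h <;> omega

lemma exists_fillsWindow_zero {β β' : ℝ} {p : ℤ} (hβ : IsUnitPair β β' p)
    (hp : 1 ≤ p ∧ β * β' = -1 ∨ 3 ≤ p ∧ β * β' = 1) :
    ∃ m : ℤ, β - 1 < m ∧ (m : ℝ) < β ∧ FillsWindow β β' β β' 0 m := by
  have h1 := hβ.one_lt
  have h2 := hβ.add_eq
  rcases hp with ⟨hp, h⟩ | ⟨hp, h⟩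
  · exact ⟨p, by nlinarith, by nlinarith, fillsWindow_of_mul_eq_neg_one h1 hp h2 h⟩
  · exact ⟨p - 1, by push_cast; nlinarith, by push_cast; nlinarith,
      fillsWindow_of_mul_eq_one h1 hp h2 h⟩

theorem fillsWindow {β β' α α' : ℝ} {p a A : ℤ} (hβ : IsUnitPair β β' p)
    (hp : 1 ≤ p ∧ β * β' = -1 ∨ 3 ≤ p ∧ β * β' = 1)
    (hα : α = β ∧ α' = β' ∨ α = -β ∧ α' = -β') (ha : a ≤ 0) (hA : 0 ≤ A)
    (hcard : β < A - a + 1) (hA1 : α = β → 1 ≤ A) : FillsWindow β β' α α' a A := by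
  have h1 := hβ.one_lt
  obtain ⟨m, hm1, hm2, hm⟩ := exists_fillsWindow_zero hβ hp
  have hm0 : 0 < m := by
    have : ((0 : ℤ) : ℝ) < m := by push_cast; linarith
    exact_mod_cast this
  have hmA : m ≤ A - a := by
    have : (m : ℝ) < A - a + 1 := by linarith
    have : m < A - a + 1 := by exact_mod_cast this
    omega
  have hβ2 : 2 < β ^ 2 := by
    have h2 := hβ.add_eq
    rcases hp with ⟨hp, h⟩ | ⟨hp, h⟩
    · have : (1 : ℝ) ≤ p := by exact_mod_cast hp
      nlinarith
    · have : (3 : ℝ) ≤ p := by exact_mod_cast hp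
      nlinarith
  have hα' := hβ.abs_conj_of_eq_or_neg hα
  have hα3 := ConjPair.of_eq_or_neg hα
  have e : (((min A m : ℤ) : ℝ) - ((min A m - m : ℤ) : ℝ)) = m := by push_cast; ring
  refine FillsWindow.mono (a := min A m - m) (A := min A m) hβ hα3 hα' ?_ (by omega) (by omega)
    (by omega) (by omega) (by omega)
  refine .of_frequently hβ hα (by omega) (by omega) (by simpa using hm) fun x => ?_
  rcases hα with ⟨rfl, -⟩ | ⟨rfl, -⟩
  · exact frequently_sub_digitShift_self_lt h1 (by have := hA1 rfl; omega) (by rwa [e]) x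
  · exact frequently_sub_digitShift_neg_lt h1 hβ2 (by omega) (by omega) (by rwa [e])
      (by rwa [e]) x

theorem isStripSet_XspecZ {β β' α α' : ℝ} {p a A : ℤ} (hβ : IsUnitPair β β' p)
    (hp : 1 ≤ p ∧ β * β' = -1 ∨ 3 ≤ p ∧ β * β' = 1)
    (hα : α = β ∧ α' = β' ∨ α = -β ∧ α' = -β') (ha : a ≤ 0) (hA : 0 ≤ A)
    (hcard : β < A - a + 1) (hA1 : α = β → 1 ≤ A) (l : ℕ) (j : ℤ) :
    IsStripSet (β ^ (-(l : ℤ))) (β ^ (-(l : ℤ)) * (j - β')) (β - j)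
      (β' ^ l * windowCenter α' a A - β ^ (-(l : ℤ)) * windowRadius β a A)
      (2 * (β ^ (-(l : ℤ)) * windowRadius β a A)) (XspecZ α a A) := by
  have hβ0 := hβ.pos
  have hα' := hβ.abs_conj_of_eq_or_neg hα
  have hα3 := ConjPair.of_eq_or_neg hα
  have hs0 : 0 < β ^ (-(l : ℤ)) := zpow_pos hβ0 _
  have hs : |β' ^ l| = β ^ (-(l : ℤ)) := by
    rw [abs_pow, hβ.abs_conj, zpow_neg, zpow_natCast, inv_pow]
  have hadd : β' = p - β := by linarith [hβ.add_eq]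
  have hmulabs (x' : ℝ) : |β' ^ l * x' - β' ^ l * windowCenter α' a A| =
      β ^ (-(l : ℤ)) * |x' - windowCenter α' a A| := by
    rw [← mul_sub, abs_mul, hs]
  constructor
  · intro x hx
    obtain ⟨x', hx'⟩ := (mem_XspecZ_iff (α' := α') ha hA).1 hx
    have hw := hx'.abs_sub_windowCenter_le hβ.one_lt hα' ha hA
    obtain ⟨u, v, e, e'⟩ := (ConjPair.self.pow hβ l).mul hβ (hx'.conjPair hβ hα3)
    refine ⟨u + v * p - v * j, v, ?_, ?_⟩
    · rw [zpow_neg, zpow_natCast]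
      have : β ^ l ≠ 0 := by positivity
      field_simp
      rw [mul_comm x, e, hadd]
      push_cast
      ring
    · have e2 : ((u + v * p - v * j : ℤ) : ℝ) - v * (β - j) = β' ^ l * x' := by
        rw [e', hadd]
        push_cast
        ring
      rw [e2]
      have h := hmulabs x'
      have h2 := mul_le_mul_of_nonneg_left hw hs0.le
      rw [← h, abs_le] at h2
      constructor <;> linarith
  · intro ε hε
    obtain ⟨R, hR⟩ := fillsWindow hβ hp hα ha hA hcard hA1 (ε / β ^ (-(l : ℤ))) (div_pos hε hs0)
    refine ⟨R, fun u v hRx h1 h2 => ?_⟩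
    have hb : β' ^ l ≠ 0 := pow_ne_zero _ hβ.conj_ne_zero
    have hconj : ConjPair β β' (u * β ^ (-(l : ℤ)) + v * (β ^ (-(l : ℤ)) * (j - β')))
        ((β' ^ l)⁻¹ * (u - v * (β - j))) := by
      have h : ConjPair β β' (u + v * (j - β')) (u - v * (β - j)) := by
        refine ⟨u + v * j - v * p, v, ?_, ?_⟩ <;> rw [hadd] <;> push_cast <;> ring
      convert ((ConjPair.inv_self hβ).pow hβ l).mul hβ h using 1
      · rw [zpow_neg, zpow_natCast, inv_pow]; ring
      · rw [inv_pow]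
    refine (mem_XspecZ_iff ha hA).2 ⟨_, hR _ _ hconj hRx ?_⟩
    refine le_of_mul_le_mul_left ?_ hs0
    rw [← hmulabs, mul_inv_cancel_left₀ hb, mul_sub (β ^ (-(l : ℤ))), mul_div_cancel₀ _ hs0.ne', abs_le]
    constructor <;> linarith

lemma finite_conjPair_bounded {β β' : ℝ} (hβ : β' < β) (R M : ℝ) :
    {x : ℝ | |x| ≤ R ∧ ∃ x', ConjPair β β' x x' ∧ |x'| ≤ M}.Finite := by
  obtain ⟨V, hV⟩ := exists_nat_gt ((R + M) / (β - β'))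
  obtain ⟨U, hU⟩ := exists_nat_gt (R + V * |β|)
  refine ((Set.finite_Icc (-U : ℤ) U).image2 (fun u v : ℤ => (u : ℝ) + v * β)
    (Set.finite_Icc (-V : ℤ) V)).subset ?_
  rintro _ ⟨hx, _, ⟨u, v, rfl, rfl⟩, hx'⟩
  rw [div_lt_iff₀ (by linarith)] at hV
  have hv : |(v : ℝ)| ≤ V := by
    have h : |(v : ℝ)| * (β - β') ≤ R + M := by
      rw [← abs_of_pos (sub_pos.2 hβ), ← abs_mul,
        show (v : ℝ) * (β - β') = (u + v * β) - (u + v * β') by ring]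
      exact (abs_sub _ _).trans (add_le_add hx hx')
    exact le_of_mul_le_mul_right (h.trans hV.le) (sub_pos.2 hβ)
  have hu : |(u : ℝ)| ≤ U := by
    have h : |(u : ℝ)| ≤ R + V * |β| := by
      rw [show (u : ℝ) = (u + v * β) - v * β by ring]
      refine (abs_sub _ _).trans (add_le_add hx ?_)
      rw [abs_mul]
      gcongr
    exact h.trans hU.le
  rw [abs_le] at hu hv
  exact ⟨u, ⟨by exact_mod_cast hu.1, by exact_mod_cast hu.2⟩, v,
    ⟨by exact_mod_cast hv.1, by exact_mod_cast hv.2⟩, rfl⟩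

lemma neg_mem_XspecZ_iff {α x : ℝ} {a A : ℤ} (ha : a ≤ 0) (hA : 0 ≤ A) :
    -x ∈ XspecZ α (-A) (-a) ↔ x ∈ XspecZ α a A := by
  rw [mem_XspecZ_iff (α' := α) ha hA, mem_XspecZ_iff (α' := α) (by omega) (by omega)]
  constructor
  · rintro ⟨x', h⟩
    exact ⟨_, by simpa using h.neg⟩
  · rintro ⟨x', h⟩
    exact ⟨_, h.neg⟩

/-- Only finitely many gaps avoid `S` once this holds far to the right and far to the left, and
the set is locally finite. -/
lemma finite_exceptional_gaps {X S : Set ℝ} {R R' : ℝ}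
    (hfin : ∀ r : ℝ, {x ∈ X | |x| ≤ r}.Finite)
    (hpos : ∀ x ∈ X, ∀ z ∈ X, R ≤ x → x < z → (∀ w ∈ X, w ≤ x ∨ z ≤ w) → z - x ∈ S)
    (hneg : ∀ x ∈ X, ∀ z ∈ X, z ≤ R' → x < z → (∀ w ∈ X, w ≤ x ∨ z ≤ w) → z - x ∈ S) :
    {x : ℝ | x ∈ X ∧ ∃ z ∈ X, x < z ∧ (∀ w ∈ X, w ≤ x ∨ z ≤ w) ∧ z - x ∉ S}.Finite := by
  have hsub : {x ∈ X | x < R' ∧ ∃ z ∈ X, R' < z ∧ ∀ w ∈ X, w ≤ x ∨ z ≤ w}.Subsingleton := by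
    rintro x ⟨hx, hxR, z, -, hzR, hxz⟩ y ⟨hy, hyR, w, -, hwR, hyw⟩
    rcases hxz y hy with h | h <;> rcases hyw x hx with h' | h' <;> linarith
  refine ((hfin (max |R| |R'|)).union hsub.finite).subset ?_
  rintro x ⟨hx, z, hz, hxz, hgap, hS⟩
  have h1 : x < R := by
    by_contra! h
    exact hS (hpos x hx z hz h hxz hgap)
  have h2 : R' < z := by
    by_contra! h
    exact hS (hneg x hx z hz h hxz hgap)
  rcases lt_or_ge x R' with h | h
  · exact Or.inr ⟨hx, h, z, hz, h2, hgap⟩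
  · refine Or.inl ⟨hx, abs_le_max_abs_abs h h1.le |>.trans (max_comm _ _).le⟩

theorem finite_XspecZ_inter {β β' α α' : ℝ} {p a A : ℤ} (hβ : IsUnitPair β β' p)
    (hα : α = β ∧ α' = β' ∨ α = -β ∧ α' = -β') (ha : a ≤ 0) (hA : 0 ≤ A) (r : ℝ) :
    {x ∈ XspecZ α a A | |x| ≤ r}.Finite := by
  have hα' := hβ.abs_conj_of_eq_or_neg hα
  have hα3 := ConjPair.of_eq_or_neg hα
  have hlt : β' < β := ((abs_lt.1 hβ.abs_conj_lt_one).2).trans hβ.one_lt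
  refine (finite_conjPair_bounded hlt r
    (|windowCenter α' a A| + windowRadius β a A)).subset ?_
  rintro x ⟨hx, hr⟩
  obtain ⟨x', hx'⟩ := (mem_XspecZ_iff (α' := α') ha hA).1 hx
  refine ⟨hr, x', hx'.conjPair hβ hα3, ?_⟩
  have h := hx'.abs_sub_windowCenter_le hβ.one_lt hα' ha hA
  have h2 := abs_add_le (windowCenter α' a A) (x' - windowCenter α' a A)
  rw [add_sub_cancel] at h2
  linarith

open Filter in
/-- Theorem (explicit gaps and frequencies): if
`β^{l-1}(β-1)·max(β-j,1) < #𝒜 - 1 ≤ β^{l-1}(β-1)(β-j+1)`, then up to finitely many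
exceptions, the gaps of `X^𝒜(α)` take the values `β^{-l}`, `β^{-l}(j-β′)`,
`β^{-l}(j+1-β′)`, and for any increasing enumeration `y` of `X^𝒜(α) ∩ [0,∞)` these
three gap values occur with frequencies `1 - β^{l-1}(β-1)/(#𝒜-1)`,
`1 - β^{l-1}(β-j)(β-1)/(#𝒜-1)`, and `-1 + β^{l-1}(β-j+1)(β-1)/(#𝒜-1)`. -/
theorem spectrum_gaps_and_frequencies (β β' α : ℝ) (p : ℤ) (a A : ℤ) (l : ℕ) (j : ℤ)
    (hβ : 1 < β)
    (hp : (1 ≤ p ∧ β ^ 2 = p * β + 1) ∨ (3 ≤ p ∧ β ^ 2 = p * β - 1))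
    (hβ' : β' = (p : ℝ) - β)
    (ha : a ≤ 0) (hA : 0 ≤ A) (hcard : (A : ℝ) - (a : ℝ) + 1 > β)
    (hj : 1 ≤ j ∧ j ≤ ⌊β⌋)
    (hlj : β ^ ((l : ℤ) - 1) * (β - 1) * max (β - (j : ℝ)) 1 < (A : ℝ) - (a : ℝ) ∧
           (A : ℝ) - (a : ℝ) ≤ β ^ ((l : ℤ) - 1) * (β - 1) * (β - (j : ℝ) + 1))
    (hα : (α = β ∧ a = 0 ∧ (A : ℝ) > β - 1) ∨
          α = -β ∨
          (α = β ∧ a ≤ -1 ∧ 1 ≤ A)) :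
    {x : ℝ | x ∈ XspecZ α a A ∧ ∃ z ∈ XspecZ α a A, x < z ∧
        (∀ w ∈ XspecZ α a A, w ≤ x ∨ z ≤ w) ∧
        z - x ∉ ({β ^ (-(l : ℤ)), β ^ (-(l : ℤ)) * ((j : ℝ) - β'),
          β ^ (-(l : ℤ)) * ((j : ℝ) + 1 - β')} : Set ℝ)}.Finite ∧
    ∀ y : ℕ → ℝ, StrictMono y → Set.range y = XspecZ α a A ∩ Set.Ici 0 →
      (Tendsto
        (fun n => (((Finset.range n).filter
            (fun k => y (k + 1) - y k = β ^ (-(l : ℤ)))).card : ℝ) / (n : ℝ))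
        atTop (nhds (1 - β ^ ((l : ℤ) - 1) * (β - 1) / ((A : ℝ) - (a : ℝ)))) ∧
      Tendsto
        (fun n => (((Finset.range n).filter
            (fun k => y (k + 1) - y k = β ^ (-(l : ℤ)) * ((j : ℝ) - β'))).card : ℝ) / (n : ℝ))
        atTop (nhds (1 - β ^ ((l : ℤ) - 1) * (β - (j : ℝ)) * (β - 1) / ((A : ℝ) - (a : ℝ)))) ∧
      Tendsto
        (fun n => (((Finset.range n).filter
            (fun k => y (k + 1) - y k = β ^ (-(l : ℤ)) * ((j : ℝ) + 1 - β'))).card : ℝ) / (n : ℝ))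
        atTop (nhds (-1 + β ^ ((l : ℤ) - 1) * (β - (j : ℝ) + 1) * (β - 1) / ((A : ℝ) - (a : ℝ))))) := by
  have hβ0 : 0 < β := by linarith
  have hadd : β + β' = p := by linarith
  have hp' : 1 ≤ p ∧ β * β' = -1 ∨ 3 ≤ p ∧ β * β' = 1 := by
    rw [hβ']
    exact hp.imp (fun h => ⟨h.1, by linear_combination -h.2⟩)
      fun h => ⟨h.1, by linear_combination -h.2⟩
  have hmul : β * β' = 1 ∨ β * β' = -1 := hp'.symm.imp And.right And.right
  have hu : IsUnitPair β β' p :=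
    ⟨hβ, irrational_of_add_eq_of_mul_eq hβ hadd hmul, hadd, hmul⟩
  have hirr := hu.irrational
  obtain ⟨α', hα'⟩ : ∃ α', α = β ∧ α' = β' ∨ α = -β ∧ α' = -β' := by
    rcases hα with h | h | h
    · exact ⟨β', Or.inl ⟨h.1, rfl⟩⟩
    · exact ⟨-β', Or.inr ⟨h, rfl⟩⟩
    · exact ⟨β', Or.inl ⟨h.1, rfl⟩⟩
  have hA1 : α = β → 1 ≤ A := by
    intro h
    rcases hα with h' | h' | h'
    · have : ((0 : ℤ) : ℝ) < A := by push_cast; linarith [h'.2.2]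
      exact_mod_cast this
    · linarith
    · exact h'.2.2
  have hg1 : 0 < β ^ (-(l : ℤ)) := zpow_pos hβ0 _
  have hj1 : (1 : ℝ) ≤ j := by exact_mod_cast hj.1
  have hγ : Irrational (β - j) := hirr.sub_intCast j
  have hγ0 : 0 < β - j := by
    have h1 : (j : ℝ) ≤ β := Int.le_floor.1 hj.2
    exact sub_pos.2 (h1.lt_of_ne (hirr.ne_int j).symm)
  have hg2 : 0 < β ^ (-(l : ℤ)) * (j - β') :=
    mul_pos hg1 (by linarith [(abs_lt.1 hu.abs_conj_lt_one).2])
  have hgirr : Irrational (β ^ (-(l : ℤ)) * (j - β') / β ^ (-(l : ℤ))) := by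
    rw [mul_div_cancel_left₀ _ hg1.ne', hβ']
    convert hirr.intCast_add (j - p) using 1
    push_cast
    ring
  have hg3 : β ^ (-(l : ℤ)) + β ^ (-(l : ℤ)) * (j - β') = β ^ (-(l : ℤ)) * (j + 1 - β') := by
    ring
  set k := β ^ ((l : ℤ) - 1) * (β - 1) with hk
  have hk0 : 0 < k := mul_pos (zpow_pos hβ0 _) (by linarith)
  have hD : (0 : ℝ) < A - a := by linarith
  have hL : ∀ b B : ℤ, 2 * (β ^ (-(l : ℤ)) * windowRadius β b B) = (B - b) / k := by
    intro b B
    have : β - 1 ≠ 0 := by linarith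
    rw [hk, zpow_sub_one₀ hβ0.ne', zpow_neg]
    unfold windowRadius
    field_simp
  have hL1 : 1 < (A - a) / k := by
    rw [lt_div_iff₀ hk0, one_mul]
    exact (le_mul_of_one_le_right hk0.le (le_max_right _ _)).trans_lt hlj.1
  have hLγ : β - j < (A - a) / k := by
    rw [lt_div_iff₀ hk0, mul_comm]
    exact (mul_le_mul_of_nonneg_left (le_max_left _ _) hk0.le).trans_lt hlj.1
  have hLγ' : (A - a) / k ≤ 1 + (β - j) := by
    rw [div_le_iff₀ hk0, mul_comm, add_comm]
    exact hlj.2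
  have hX := isStripSet_XspecZ hu hp' hα' ha hA hcard hA1 l j
  rw [hL] at hX
  constructor
  · obtain ⟨R, hR⟩ := hX.exists_gap_mem hg1 hg2 hγ hγ0 hL1 hLγ hLγ'
    obtain ⟨R', hR'⟩ : ∃ R' : ℝ, ∀ x ∈ XspecZ α a A, ∀ z ∈ XspecZ α a A, z ≤ R' → x < z →
        (∀ w ∈ XspecZ α a A, w ≤ x ∨ z ≤ w) →
        z - x ∈ ({β ^ (-(l : ℤ)), β ^ (-(l : ℤ)) * ((j : ℝ) - β'),
          β ^ (-(l : ℤ)) * ((j : ℝ) + 1 - β')} : Set ℝ) := by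
      by_cases h : α = β ∧ a = 0
      · obtain ⟨rfl, rfl⟩ := h
        refine ⟨0, fun x hx z hz hz0 hxz _ => ?_⟩
        obtain ⟨x', hx'⟩ := (mem_XspecZ_iff (α' := α) ha hA).1 hx
        linarith [hx'.nonneg hβ0.le]
      · have hX' := isStripSet_XspecZ (a := -A) (A := -a) hu hp' hα' (by omega) (by omega)
          (by push_cast; linarith) (fun e => by
            rcases hα with h' | h' | h'
            · exact absurd ⟨h'.1, h'.2.1⟩ h
            · linarith
            · omega) l j
        have hDneg : (((-a : ℤ) : ℝ) - ((-A : ℤ) : ℝ)) = A - a := by push_cast; ring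
        rw [hL, hDneg] at hX'
        obtain ⟨R', hR'⟩ := hX'.exists_gap_mem hg1 hg2 hγ hγ0 hL1 hLγ hLγ'
        refine ⟨-R', fun x hx z hz hz' hxz hgap => ?_⟩
        have := hR' (-z) ((neg_mem_XspecZ_iff ha hA).2 hz) (-x)
          ((neg_mem_XspecZ_iff ha hA).2 hx) (by linarith) (by linarith) fun w hw => by
            rw [← neg_neg w, neg_mem_XspecZ_iff ha hA] at hw
            rcases hgap _ hw with h | h
            · exact Or.inr (by linarith)
            · exact Or.inl (by linarith)
        rw [hg3, show -x - -z = z - x by ring] at this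
        simpa using this
    refine finite_exceptional_gaps (finite_XspecZ_inter hu hα' ha hA) (R := R) ?_ hR'
    intro x hx z hz hRx hxz hgap
    have := hR x hx z hz hRx hxz hgap
    rw [hg3] at this
    simpa using this
  · intro y hy hr
    obtain ⟨h1, h2, h3⟩ :=
      hX.tendsto_gap_frequencies hg1 hg2 hgirr hγ hγ0 hL1 hLγ hLγ' hy hr
    rw [hg3] at h3
    rw [one_div_div] at h1
    refine ⟨h1, ?_, ?_⟩
    · convert h2 using 2
      rw [div_div_eq_mul_div, hk]
      ring
    · convert h3 using 2
      rw [div_div_eq_mul_div, hk]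
      ring
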